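/- arXiv:2009.13947 — 12 statements merged into one kernel-verified Lean document; each statement's English description precedes it below -/
import Mathlib

section
/- Let F be a field, let W be an F-vector space of finite dimension m, let β : W → W → F be a bilinear form, let X_W be an F-linear endomorphism of W, let w ∈ W and ν₀ ∈ F. Define the F-linear endomorphism X_V of V := W ⊕ F by X_V(v, t) = (−X_W(v) + t·ν₀·w, −β(w, v)). Let P ∈ F[T] denote the characteristic polynomial of −X_W and let D : F[T] → F[T] be the F-linear map determined by D(T^{i+1}) = T^i for all i ≥ 0 and D(1) = 0. Then the characteristic polynomial of X_V equals T·P(T) + Σ_{j=0}^{m−1} (−1)^j · ν₀ · β(w, X_W^j(w)) · D^{j+1}(P(T)). -/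
open Polynomial

theorem Polynomial.coeff_divX_iterate {R : Type*} [Semiring R] (p : R[X]) (k n : ℕ) :
    (divX^[k] p).coeff n = p.coeff (n + k) := by
  induction k generalizing n with
  | zero => simp
  | succ k ih => rw [Function.iterate_succ_apply', coeff_divX, ih, add_right_comm, add_assoc]

theorem Polynomial.X_sub_mul_sum_divX_iterate {R E : Type*} [CommRing R] [Ring E] [Algebra R E]
    [Algebra R[X] E] [IsScalarTower R R[X] E] (a : E) (p : R[X]) (N : ℕ) :
    (algebraMap R[X] E X - a) * ∑ j ∈ Finset.range N, divX^[j + 1] p • a ^ j =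
      algebraMap R[X] E p - divX^[N] p • a ^ N - ∑ j ∈ Finset.range N, p.coeff j • a ^ j := by
  induction N with
  | zero => simp [Algebra.smul_def]
  | succ N ih =>
    have h : divX^[N] p = X * divX^[N + 1] p + C (p.coeff N) := by
      rw [Function.iterate_succ_apply']
      conv_lhs => rw [← X_mul_divX_add (divX^[N] p)]
      rw [coeff_divX_iterate, zero_add]
    rw [Finset.sum_range_succ, mul_add, ih, Finset.sum_range_succ, h, add_smul, sub_mul,
      ← Algebra.smul_def, smul_smul, mul_smul_comm, ← pow_succ', C_eq_algebraMap, algebraMap_smul]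
    abel

theorem Polynomial.X_sub_mul_sum_divX_iterate_of_natDegree_le {R E : Type*} [CommRing R] [Ring E]
    [Algebra R E] [Algebra R[X] E] [IsScalarTower R R[X] E] (a : E) {p : R[X]} {N : ℕ}
    (hN : p.natDegree ≤ N) :
    (algebraMap R[X] E X - a) * ∑ j ∈ Finset.range N, divX^[j + 1] p • a ^ j =
      algebraMap R[X] E p - aeval a p := by
  have h : divX^[N] p = C (p.coeff N) := by
    ext n
    rw [coeff_divX_iterate, coeff_C]
    split_ifs with hn
    · simp [hn]
    · exact coeff_eq_zero_of_natDegree_lt (by omega)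
  rw [X_sub_mul_sum_divX_iterate, aeval_eq_sum_range' (Nat.lt_succ_of_le hN),
    Finset.sum_range_succ, h, C_eq_algebraMap, algebraMap_smul]
  abel

namespace Matrix

variable {R n : Type*} [CommRing R] [Fintype n] [DecidableEq n]

theorem charmatrix_mul_sum_divX_iterate_charpoly (A : Matrix n n R) :
    charmatrix A * ∑ j ∈ Finset.range (Fintype.card n),
        divX^[j + 1] A.charpoly • (C : R →+* R[X]).mapMatrix A ^ j =
      scalar n A.charpoly := by
  nontriviality R
  have h0 : aeval ((C : R →+* R[X]).mapMatrix A) A.charpoly = 0 := by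
    have h := aeval_algHom_apply ((CAlgHom (R := R) (A := R)).mapMatrix (m := n)) A A.charpoly
    rw [aeval_self_charpoly, map_zero] at h
    exact h
  have h := X_sub_mul_sum_divX_iterate_of_natDegree_le ((C : R →+* R[X]).mapMatrix A)
    (charpoly_natDegree_eq_dim A).le
  rw [h0, sub_zero] at h
  exact h

/-- The characteristic polynomial of a matrix bordered by one column, one row and a zero corner. -/
theorem charpoly_fromBlocks_replicateCol_replicateRow_zero (A : Matrix n n R) (u r : n → R) :
    (fromBlocks A (replicateCol Unit u) (replicateRow Unit r) 0).charpoly =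
      X * A.charpoly - ∑ j ∈ Finset.range (Fintype.card n),
        (r ⬝ᵥ (A ^ j *ᵥ u)) • divX^[j + 1] A.charpoly := by
  set S := ∑ j ∈ Finset.range (Fintype.card n),
    divX^[j + 1] A.charpoly • (C : R →+* R[X]).mapMatrix A ^ j with hS
  set U : Matrix n Unit R[X] := (replicateCol Unit u).map C with hU
  set V : Matrix Unit n R[X] := (replicateRow Unit r).map C with hV
  have hBS : charmatrix A * (S * U) = A.charpoly • U := by
    rw [← Matrix.mul_assoc, charmatrix_mul_sum_divX_iterate_charpoly, scalar_apply,
      ← smul_eq_diagonal_mul]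
  have hVSU : (V * (S * U)) () () = ∑ j ∈ Finset.range (Fintype.card n),
      (r ⬝ᵥ (A ^ j *ᵥ u)) • divX^[j + 1] A.charpoly := by
    rw [hS, Matrix.sum_mul, Matrix.mul_sum, Matrix.sum_apply]
    refine Finset.sum_congr rfl fun j _ => ?_
    rw [← map_pow, Matrix.smul_mul, Matrix.mul_smul, smul_apply, hU, hV, RingHom.mapMatrix_apply,
      ← Matrix.map_mul, ← Matrix.map_mul, map_apply, smul_eq_mul, mul_comm, ← smul_eq_C_mul]
    rfl
  have hmul : charmatrix (fromBlocks A (replicateCol Unit u) (replicateRow Unit r) 0) *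
      fromBlocks 1 (S * U) 0 (scalar Unit A.charpoly) =
      fromBlocks (charmatrix A) 0 (-V) (scalar Unit (X * A.charpoly) - V * (S * U)) := by
    rw [charmatrix_fromBlocks, fromBlocks_multiply, hBS]
    congr 1
    · simp
    · ext i j
      simp [hU, mul_comm]
    · simp [hV]
    · ext i j
      simp [hV, charmatrix, sub_eq_neg_add]
  have hdet := congrArg det hmul
  rw [det_mul, det_fromBlocks_zero₂₁, det_fromBlocks_zero₁₂, det_one, one_mul,
    det_unique (n := Unit), det_unique (n := Unit)] at hdet
  apply (charpoly_monic A).isRegular.right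
  simp only [sub_apply, PUnit.default_eq_unit, hVSU, scalar_apply, diagonal_apply_eq] at hdet
  exact hdet.trans (mul_comm _ _)

end Matrix

/-- Let `F` be a field, `W` a finite-dimensional `F`-vector space of
dimension `m`, `β` a bilinear form on `W`, `XW` an endomorphism of `W`, `w ∈ W`, `ν₀ ∈ F`.
Define `XV` on `V = W ⊕ F` by `XV (v, t) = (−XW v + t·ν₀·w, −β w v)`.  Then the
characteristic polynomial of `XV` equals
`T·P(T) + Σ_{j=0}^{m−1} (−1)^j·ν₀·β(w, XW^j w)·D^{j+1}(P(T))`, where `P` is the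
characteristic polynomial of `−XW` and `D` is the `F`-linear map with `D(T^{i+1}) = T^i`,
`D(1) = 0` (realized by `Polynomial.divX`). -/
theorem stmt_0 (F : Type*) [Field F] (W : Type*) [AddCommGroup W] [Module F W]
    [Module.Finite F W] (m : ℕ) (hm : Module.finrank F W = m)
    (β : W →ₗ[F] W →ₗ[F] F) (XW : Module.End F W) (w : W) (ν₀ : F)
    (XV : Module.End F (W × F))
    (hXV : ∀ (v : W) (t : F), XV (v, t) = (-(XW v) + (t * ν₀) • w, -(β w v))) :
    LinearMap.charpoly XV =
      X * LinearMap.charpoly (-XW) +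
        ∑ j ∈ Finset.range m,
          ((-1 : F) ^ j * ν₀ * β w ((XW ^ j) w)) •
            Polynomial.divX^[j + 1] (LinearMap.charpoly (-XW)) := by
  subst hm
  let b := Module.finBasis F W
  let c := b.prod (Module.Basis.singleton Unit F)
  let A := LinearMap.toMatrix b b (-XW)
  let u : Fin (Module.finrank F W) → F := b.repr (ν₀ • w)
  let r : Fin (Module.finrank F W) → F := fun i => -β w (b i)
  have hM : LinearMap.toMatrix c c XV =
      Matrix.fromBlocks A (Matrix.replicateCol Unit u) (Matrix.replicateRow Unit r) 0 := by
    ext i j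
    rcases i with i | i <;> rcases j with j | j <;>
      simp [c, A, u, r, LinearMap.toMatrix_apply, hXV]
  have hr (x : W) : r ⬝ᵥ b.repr x = -β w x := by
    conv_rhs => rw [← b.sum_repr x, map_sum]
    simp [r, dotProduct, mul_comm]
  have hA (j : ℕ) : r ⬝ᵥ (A ^ j).mulVec u = -((-1) ^ j * ν₀ * β w ((XW ^ j) w)) := by
    simp only [A, u]
    rw [LinearMap.toMatrix_pow, LinearMap.toMatrix_mulVec_repr, hr, ← neg_one_smul F XW,
      _root_.smul_pow]
    simp [mul_assoc, mul_left_comm]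
  rw [← LinearMap.charpoly_toMatrix XV c, hM,
    Matrix.charpoly_fromBlocks_replicateCol_replicateRow_zero, LinearMap.charpoly_toMatrix]
  simp [hA, sub_eq_add_neg]
end

section
/- Let F be a field, m ≥ 0, A an m×m matrix over F, and u, c ∈ F^m. Over the polynomial ring F[T], form the (m+1)×(m+1) block matrix M(T) whose top-left m×m block is T·1_m + A, whose top-right column is u, whose bottom-left row is c, and whose bottom-right entry is 0. Then det M(T) = Σ_{j=0}^{m−1} (−1)^{j+1} · (c · A^j · u) · D^{j+1}(P(T)), where P(T) = det(T·1_m + A) is the characteristic polynomial of −A, c · A^j · u denotes the scalar Σ_{k,l} c_k (A^j)_{kl} u_l, and D : F[T] → F[T] is the F-linear map determined by D(T^{i+1}) = T^i for all i ≥ 0 and D(1) = 0. -/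
open Polynomial Matrix

theorem Matrix.det_fromBlocks_zero_eq_neg_of_mul_eq_det_smul {R n : Type*} [CommRing R] [IsDomain R]
    [Fintype n] [DecidableEq n] {N Q : Matrix n n R} (hN : N.det ≠ 0)
    (h : N * Q = N.det • (1 : Matrix n n R)) (u : Matrix n Unit R) (c : Matrix Unit n R) :
    (fromBlocks N u c 0).det = -(c * Q * u).det := by
  have key : fromBlocks N u c (0 : Matrix Unit Unit R) *
      fromBlocks Q (-(Q * u)) 0 (N.det • (1 : Matrix Unit Unit R)) =
      fromBlocks (N.det • (1 : Matrix n n R)) 0 (c * Q) (-(c * Q * u)) := by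
    rw [fromBlocks_multiply]
    simp [← Matrix.mul_assoc, h]
  have hQ : N.det * Q.det = N.det ^ Fintype.card n := by
    rw [← det_mul, h, det_smul, det_one, mul_one]
  have hdet := congrArg det key
  rw [det_mul, det_fromBlocks_zero₂₁, det_fromBlocks_zero₁₂, det_smul, det_smul, det_one, det_one,
    det_neg] at hdet
  simp only [Fintype.card_unit, pow_one, mul_one] at hdet
  refine mul_left_cancel₀ (pow_ne_zero (Fintype.card n) hN) ?_
  linear_combination hdet - (fromBlocks N u c (0 : Matrix Unit Unit R)).det * hQ

theorem Polynomial.coeff_iterate_divX {R : Type*} [Semiring R] (p : R[X]) (j n : ℕ) :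
    (divX^[j] p).coeff n = p.coeff (n + j) := by
  induction j generalizing n with
  | zero => rfl
  | succ j ih => rw [Function.iterate_succ_apply', coeff_divX, ih]; congr 1; omega

theorem Polynomial.iterate_divX_eq_zero {R : Type*} [Semiring R] {p : R[X]} {j : ℕ}
    (h : p.natDegree < j) : divX^[j] p = 0 := by
  ext n
  rw [coeff_iterate_divX, coeff_zero]
  exact coeff_eq_zero_of_natDegree_lt (by omega)

theorem Polynomial.X_mul_iterate_divX_succ {R : Type*} [CommRing R] (p : R[X]) (j : ℕ) :
    X * divX^[j + 1] p = divX^[j] p - C (p.coeff j) := by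
  have h := X_mul_divX_add (divX^[j] p)
  rw [coeff_iterate_divX, zero_add] at h
  rw [Function.iterate_succ_apply', eq_sub_iff_add_eq, h]

theorem Matrix.charmatrix_mul_sum_iterate_divX {R n : Type*} [CommRing R]
    [Fintype n] [DecidableEq n] (B : Matrix n n R) (p : R[X]) (k : ℕ) :
    B.charmatrix * ∑ j ∈ Finset.range k, divX^[j + 1] p • (B ^ j).map C =
      p • (1 : Matrix n n R[X]) - divX^[k] p • (B ^ k).map C -
        (∑ j ∈ Finset.range k, p.coeff j • B ^ j).map C := by
  have hN : B.charmatrix = (X : R[X]) • (1 : Matrix n n R[X]) - B.map C := by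
    ext1 i j
    simp [charmatrix_apply, Matrix.one_apply, diagonal_apply]
  induction k with
  | zero => simp [Matrix.map_one]
  | succ k ih =>
    have hmap : (∑ j ∈ Finset.range k, p.coeff j • B ^ j + p.coeff k • B ^ k).map C =
        (∑ j ∈ Finset.range k, p.coeff j • B ^ j).map C + C (p.coeff k) • (B ^ k).map C := by
      ext1 i j
      simp
    have hpow : (B ^ (k + 1)).map C = B.map C * (B ^ k).map (C : R →+* R[X]) := by
      rw [pow_succ', Matrix.map_mul]
    rw [Finset.sum_range_succ, mul_add, ih, Finset.sum_range_succ, hmap, hpow, hN, sub_mul,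
      Matrix.smul_mul, Matrix.one_mul, Matrix.mul_smul, smul_smul, X_mul_iterate_divX_succ, sub_smul]
    abel

theorem Matrix.charmatrix_mul_sum_iterate_divX_charpoly {R n : Type*} [CommRing R] [Nontrivial R]
    [Fintype n] [DecidableEq n] (B : Matrix n n R) :
    B.charmatrix * ∑ j ∈ Finset.range (Fintype.card n), divX^[j + 1] B.charpoly • (B ^ j).map C =
      B.charpoly • (1 : Matrix n n R[X]) := by
  have hdeg : B.charpoly.natDegree < Fintype.card n + 1 := by
    rw [charpoly_natDegree_eq_dim]; omega
  have h := charmatrix_mul_sum_iterate_divX B B.charpoly (Fintype.card n + 1)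
  rw [← aeval_eq_sum_range' hdeg, aeval_self_charpoly, Finset.sum_range_succ,
    iterate_divX_eq_zero hdeg] at h
  simpa using h

/-- For an `m×m` matrix `A` over a field `F` and vectors `u, c ∈ F^m`,
the determinant of the `(m+1)×(m+1)` block matrix with blocks `T·1 + A`, `u`, `c`, `0`
over `F[T]` equals `Σ_{j=0}^{m−1} (−1)^{j+1}·(c·A^j·u)·D^{j+1}(P(T))`, where
`P(T) = det(T·1 + A)` is the characteristic polynomial of `−A` and `D` is the linear
shift operator (realized by `Polynomial.divX`). -/
theorem stmt_1 (F : Type*) [Field F] (m : ℕ) (A : Matrix (Fin m) (Fin m) F)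
    (u c : Fin m → F) :
    (Matrix.fromBlocks
        ((X : F[X]) • (1 : Matrix (Fin m) (Fin m) F[X]) + A.map Polynomial.C)
        (Matrix.of fun i (_ : Unit) => Polynomial.C (u i))
        (Matrix.of fun (_ : Unit) j => Polynomial.C (c j))
        (0 : Matrix Unit Unit F[X])).det =
      ∑ j ∈ Finset.range m,
        ((-1 : F) ^ (j + 1) * (c ⬝ᵥ (A ^ j).mulVec u)) •
          Polynomial.divX^[j + 1]
            ((X : F[X]) • (1 : Matrix (Fin m) (Fin m) F[X]) + A.map Polynomial.C).det := by
  have hN : (X : F[X]) • (1 : Matrix (Fin m) (Fin m) F[X]) + A.map C = (-A).charmatrix := by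
    ext1 i j
    simp [charmatrix_apply, Matrix.one_apply, diagonal_apply]
  have hQ := charmatrix_mul_sum_iterate_divX_charpoly (-A)
  rw [Fintype.card_fin] at hQ
  rw [hN, det_fromBlocks_zero_eq_neg_of_mul_eq_det_smul (charpoly_monic (-A)).ne_zero hQ,
    det_unique, Matrix.mul_sum, Matrix.sum_mul, Matrix.sum_apply, ← Finset.sum_neg_distrib]
  refine Finset.sum_congr rfl fun j _ => ?_
  have hentry : ((Matrix.of fun (_ : Unit) i => C (c i)) * (A ^ j).map C *
      Matrix.of fun i (_ : Unit) => C (u i)) default default = C (c ⬝ᵥ (A ^ j).mulVec u) := by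
    rw [dotProduct_mulVec]
    simp [Matrix.mul_apply, dotProduct, vecMul, map_sum]
  have hneg : ((-A) ^ j).map C = C ((-1 : F) ^ j) • (A ^ j).map C := by
    rw [← neg_one_smul F A, _root_.smul_pow]
    ext1 i k
    simp
  rw [hneg, Matrix.mul_smul, Matrix.mul_smul, Matrix.smul_mul, Matrix.smul_mul, Matrix.smul_apply,
    Matrix.smul_apply, hentry, charpoly, smul_eq_C_mul]
  simp only [smul_eq_mul, map_mul, map_pow, map_neg, map_one]
  ring
end

section
/- With the data (I, (F_i^#), (F_i), (τ_i), (a_i), (c_i), W, q_W, X_W) as in the context, let F̄ be an algebraic closure of F, for each i let Σ(F_i) be the set of F-algebra homomorphisms F_i → F̄, and suppose (f_{i,σ}) (for i ∈ I, σ ∈ Σ(F_i)) is a family of elements with f_{i,σ} in the subspace F̄ ⊗_F F_i of F̄ ⊗_F W such that for every i ∈ I and every v ∈ F_i one has 1 ⊗ v = Σ_{σ ∈ Σ(F_i)} σ(v)·f_{i,σ}. Let q̄_W denote the F̄-bilinear extension of q_W to F̄ ⊗_F W. Then for all (i,σ) and (i',σ'), q̄_W(f_{i',σ'}, f_{i,σ})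 = σ(c_i)·[F_i:F]^{-1} if (i',σ') = (i, σ∘τ_i), and q̄_W(f_{i',σ'}, f_{i,σ}) = 0 otherwise. -/
open scoped TensorProduct

/-- One factor `F_i` of the data in the context: a finite field extension `Fs = F_i^#` of
`F`, an étale quadratic `Fs`-algebra `A = F_i` (reduced and free of rank 2 over `Fs`,
hence either a quadratic field extension of `Fs` or `Fs × Fs`), the nontrivial
`Fs`-algebra involution `τ` with fixed subalgebra `Fs`, and units `a, c ∈ A` with
`τ a = −a`, `τ c = c` and `a` generating `A` as an `F`-algebra. -/
structure QuadDatum (F : Type*) [Field F] where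
  Fs : Type*
  [fieldFs : Field Fs]
  [algFFs : Algebra F Fs]
  [finFFs : FiniteDimensional F Fs]
  A : Type*
  [ringA : CommRing A]
  [algFA : Algebra F A]
  [algFsA : Algebra Fs A]
  [towerA : IsScalarTower F Fs A]
  [redA : IsReduced A]
  [finFA : Module.Finite F A]
  [freeFsA : Module.Free Fs A]
  rank_two : Module.finrank Fs A = 2
  τ : A ≃ₐ[Fs] A
  τ_ne : τ ≠ AlgEquiv.refl
  τ_invol : ∀ x : A, τ (τ x) = x
  τ_fixed : ∀ x : A, τ x = x ↔ x ∈ (algebraMap Fs A).range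
  a : A
  a_unit : IsUnit a
  τ_a : τ a = -a
  a_gen : Algebra.adjoin F {a} = ⊤
  c : A
  c_unit : IsUnit c
  τ_c : τ c = c

attribute [instance] QuadDatum.fieldFs QuadDatum.algFFs QuadDatum.finFFs QuadDatum.ringA
  QuadDatum.algFA QuadDatum.algFsA QuadDatum.towerA QuadDatum.redA QuadDatum.finFA
  QuadDatum.freeFsA

section
variable {F K A : Type*} [Field F] [Field K] [Algebra F K] [CommRing A] [Algebra F A]

/-- The `K`-linear extension of an `F`-algebra homomorphism to the scalar extension. -/
noncomputable def AlgHom.tensorLift (σ : A →ₐ[F] K) : K ⊗[F] A →ₐ[K] K :=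
  Algebra.TensorProduct.lift (AlgHom.id K K) σ fun _ _ => Commute.all _ _

@[simp]
theorem AlgHom.tensorLift_tmul (σ : A →ₐ[F] K) (x : K) (v : A) :
    σ.tensorLift (x ⊗ₜ[F] v) = x * σ v := by
  simp [AlgHom.tensorLift]

variable [Fintype (A →ₐ[F] K)] {e : (A →ₐ[F] K) → K ⊗[F] A}

theorem AlgHom.tensorLift_apply_of_sum_smul_eq [DecidableEq (A →ₐ[F] K)]
    (he : ∀ v : A, (1 : K) ⊗ₜ[F] v = ∑ σ : A →ₐ[F] K, σ v • e σ) (ρ σ : A →ₐ[F] K) :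
    ρ.tensorLift (e σ) = if σ = ρ then 1 else 0 := by
  have hli := Fintype.linearIndependent_iff.1 (linearIndependent_algHom_toLinearMap F A K)
    (fun σ => ρ.tensorLift (e σ) - if σ = ρ then 1 else 0) (by
      ext v
      have h := congrArg ρ.tensorLift (he v)
      simp only [tensorLift_tmul, one_mul, map_sum, map_smul, smul_eq_mul] at h
      simp [sub_mul, Finset.sum_sub_distrib, h, mul_comm (ρ.tensorLift _)])
  exact sub_eq_zero.1 (hli σ)

theorem algebraMap_trace_eq_sum_algHom [Module.Finite F A]
    (he : ∀ v : A, (1 : K) ⊗ₜ[F] v = ∑ σ : A →ₐ[F] K, σ v • e σ) (x : A) :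
    algebraMap F K (Algebra.trace F A x) = ∑ σ : A →ₐ[F] K, σ x := by
  classical
  rw [Algebra.trace_apply, ← LinearMap.trace_baseChange]
  have h : (Algebra.lmul F A x).baseChange K =
      ∑ σ : A →ₐ[F] K, σ x • σ.tensorLift.toLinearMap.smulRight (e σ) := by
    ext v
    simp [he (x * v), mul_smul]
  rw [h]
  simp [AlgHom.tensorLift_apply_of_sum_smul_eq he]

/-- A form on `K ⊗[F] A` extending `(v, w) ↦ r • Tr (τ v * w * c)` pairs the idempotents of
`σ'` and `σ` nontrivially only if `σ' = σ ∘ τ`. -/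
theorem bilin_apply_of_trace_form [Module.Finite F A] [DecidableEq (A →ₐ[F] K)]
    (he : ∀ v : A, (1 : K) ⊗ₜ[F] v = ∑ σ : A →ₐ[F] K, σ v • e σ)
    (τ : A →ₐ[F] A) (c : A) (r : F) (β : K ⊗[F] A →ₗ[K] K ⊗[F] A →ₗ[K] K)
    (hβ : ∀ (x y : K) (v w : A), β (x ⊗ₜ[F] v) (y ⊗ₜ[F] w) =
      x * y * algebraMap F K (r * Algebra.trace F A (τ v * w * c)))
    (σ σ' : A →ₐ[F] K) :
    β (e σ') (e σ) = if σ' = σ.comp τ then σ c * algebraMap F K r else 0 := by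
  have key : ∀ x y : K ⊗[F] A, β x y = algebraMap F K r *
      ∑ ρ : A →ₐ[F] K, (ρ.comp τ).tensorLift x * ρ.tensorLift y * ρ c := by
    intro x y
    induction x with
    | zero => simp
    | add x₁ x₂ h₁ h₂ => simp [h₁, h₂, add_mul, Finset.sum_add_distrib, mul_add]
    | tmul x v =>
      induction y with
      | zero => simp
      | add y₁ y₂ h₁ h₂ => simp only [h₁, h₂, map_add, add_mul, Finset.sum_add_distrib, mul_add]
      | tmul y w =>
        rw [hβ, map_mul, algebraMap_trace_eq_sum_algHom he]
        simp only [map_mul, AlgHom.tensorLift_tmul, AlgHom.comp_apply, Finset.mul_sum]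
        exact Finset.sum_congr rfl fun _ _ => by ring
  rw [key, Finset.sum_eq_single σ
    (fun ρ _ hρ => by simp [AlgHom.tensorLift_apply_of_sum_smul_eq he, hρ.symm]) (by simp)]
  simp [AlgHom.tensorLift_apply_of_sum_smul_eq he, mul_comm]
end

/-- With `W = ⊕_i F_i`, `q_W` the symmetric bilinear form
`q_W(v, w) = Σ_i [F_i:F]⁻¹·Tr_{F_i/F}(τ_i(v_i)·w_i·c_i)`, `K = F̄`, a family `f_{i,σ}` of
elements of `K ⊗_F F_i ⊆ K ⊗_F W` with `1 ⊗ v = Σ_σ σ(v) • f_{i,σ}` for all `v ∈ F_i`,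
and `q̄_W` the `K`-bilinear extension of `q_W` to `K ⊗_F W`, one has
`q̄_W(f_{i',σ'}, f_{i,σ}) = σ(c_i)·[F_i:F]⁻¹` if `(i',σ') = (i, σ∘τ_i)` and `= 0`
otherwise. -/
theorem stmt_7 (F : Type*) [Field F] [CharZero F]
    (I : Type*) [Fintype I] [DecidableEq I] (D : I → QuadDatum F)
    (hdist : ∀ i j : I, i ≠ j → ∀ e : (D i).A ≃ₐ[F] (D j).A, e (D i).a ≠ (D j).a)
    (K : Type*) [Field K] [Algebra F K] [IsAlgClosure F K]
    (qW : (∀ i, (D i).A) → (∀ i, (D i).A) → F)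
    (hqW : ∀ v w : ∀ i, (D i).A, qW v w =
      ∑ i, (Module.finrank F (D i).A : F)⁻¹ *
        Algebra.trace F (D i).A ((D i).τ (v i) * w i * (D i).c))
    (f : ∀ i : I, ((D i).A →ₐ[F] K) → K ⊗[F] (∀ j, (D j).A))
    (hmem : ∀ (i : I) (σ : (D i).A →ₐ[F] K),
      f i σ ∈ LinearMap.range (LinearMap.lTensor K (LinearMap.single F (fun j => (D j).A) i)))
    (hexp : ∀ (i : I) (v : (D i).A),
      (1 : K) ⊗ₜ[F] (Pi.single i v : ∀ j, (D j).A) = ∑ᶠ σ : (D i).A →ₐ[F] K, σ v • f i σ)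
    (qbar : (K ⊗[F] (∀ i, (D i).A)) →ₗ[K] (K ⊗[F] (∀ i, (D i).A)) →ₗ[K] K)
    (hqbar : ∀ (x y : K) (v w : ∀ i, (D i).A),
      qbar (x ⊗ₜ[F] v) (y ⊗ₜ[F] w) = x * y * algebraMap F K (qW v w)) :
    (∀ (i : I) (σ σ' : (D i).A →ₐ[F] K),
      (σ' = σ.comp ((AlgEquiv.restrictScalars F (D i).τ : (D i).A ≃ₐ[F] (D i).A) :
          (D i).A →ₐ[F] (D i).A) →
        qbar (f i σ') (f i σ) = σ (D i).c * (Module.finrank F (D i).A : K)⁻¹) ∧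
      (σ' ≠ σ.comp ((AlgEquiv.restrictScalars F (D i).τ : (D i).A ≃ₐ[F] (D i).A) :
          (D i).A →ₐ[F] (D i).A) →
        qbar (f i σ') (f i σ) = 0)) ∧
    (∀ i i' : I, i ≠ i' → ∀ (σ : (D i).A →ₐ[F] K) (σ' : (D i').A →ₐ[F] K),
      qbar (f i' σ') (f i σ) = 0) := by
  classical
  have hft : ∀ i, Fintype ((D i).A →ₐ[F] K) := fun i => Fintype.ofFinite _
  choose e hef using hmem
  replace hef : ∀ i σ,
      (LinearMap.single F (fun j => (D j).A) i).baseChange K (e i σ) = f i σ := hef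
  have he : ∀ i (v : (D i).A), (1 : K) ⊗ₜ[F] v = ∑ σ : (D i).A →ₐ[F] K, σ v • e i σ := by
    intro i v
    have hps : LinearMap.proj i ∘ₗ LinearMap.single F (fun j => (D j).A) i = LinearMap.id :=
      LinearMap.proj_comp_single_same F _ i
    have h := congrArg ((LinearMap.proj (R := F) (φ := fun j => (D j).A) i).baseChange K)
      (hexp i v)
    rw [finsum_eq_sum_of_fintype] at h
    simp only [← hef, map_sum, map_smul, ← LinearMap.comp_apply, ← LinearMap.baseChange_comp,
      hps, LinearMap.baseChange_id, LinearMap.baseChange_tmul] at h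
    simpa using h
  have hsingle : ∀ i (v w : (D i).A), qW (Pi.single i v) (Pi.single i w) =
      (Module.finrank F (D i).A : F)⁻¹ * Algebra.trace F (D i).A ((D i).τ v * w * (D i).c) := by
    intro i v w
    rw [hqW, Finset.sum_eq_single i (fun j _ hj => by simp [hj]) (by simp)]
    simp
  have hform : ∀ i (σ σ' : (D i).A →ₐ[F] K), qbar (f i σ') (f i σ) =
      if σ' = σ.comp ((AlgEquiv.restrictScalars F (D i).τ : (D i).A ≃ₐ[F] (D i).A) :
          (D i).A →ₐ[F] (D i).A)
      then σ (D i).c * (Module.finrank F (D i).A : K)⁻¹ else 0 := by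
    intro i σ σ'
    have h := bilin_apply_of_trace_form (he i)
      ((AlgEquiv.restrictScalars F (D i).τ : (D i).A ≃ₐ[F] (D i).A) : (D i).A →ₐ[F] (D i).A)
      (D i).c (Module.finrank F (D i).A : F)⁻¹
      (qbar.compl₁₂ ((LinearMap.single F (fun j => (D j).A) i).baseChange K)
        ((LinearMap.single F (fun j => (D j).A) i).baseChange K))
      (fun x y v w => by simp [hqbar, hsingle]) σ σ'
    simp only [LinearMap.compl₁₂_apply, hef, map_inv₀, map_natCast] at h
    convert h
  refine ⟨fun i σ σ' => ⟨fun h => by rw [hform, if_pos h], fun h => by rw [hform, if_neg h]⟩,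
    fun i i' hi σ σ' => ?_⟩
  have hzero : qbar.compl₁₂ ((LinearMap.single F (fun j => (D j).A) i').baseChange K)
      ((LinearMap.single F (fun j => (D j).A) i).baseChange K) = 0 := by
    ext v w
    have hq : qW (Pi.single i' v) (Pi.single i w) = 0 := by
      rw [hqW]
      refine Finset.sum_eq_zero fun j _ => ?_
      by_cases hj : j = i
      · subst hj
        simp [hi]
      · simp [hj]
    simp [hqbar, hq]
  simpa [hef] using LinearMap.congr_fun₂ hzero (e i' σ') (e i σ)
end

section
/- With the data (I, (F_i^#), (F_i), (τ_i), (a_i), (c_i), W, q_W, X_W) as in the context, the characteristic polynomial of the F-linear endomorphism X_W of W is squarefree (equivalently, X_W has pairwise distinct eigenvalues in an algebraic closure of F) and has nonzero constant coefficient (equivalently, X_W is invertible). -/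
open scoped TensorProduct

open Polynomial in
/-- A divisor of the minimal polynomial of `x` that takes a unit value at `x` is a unit. -/
theorem Polynomial.isUnit_of_dvd_minpoly_of_isUnit_aeval {F A : Type*} [Field F]
    [CommRing A] [Algebra F A] {x : A} (hx : IsIntegral F x) {g : F[X]} (hg : g ∣ minpoly F x)
    (hu : IsUnit (aeval x g)) :
    IsUnit g := by
  obtain ⟨h, hh⟩ := hg
  have hxh : aeval x h = 0 := by
    rw [← hu.mul_right_eq_zero, ← map_mul, ← hh, minpoly.aeval]
  have hdvd : g * h ∣ 1 * h := by
    rw [← hh, one_mul]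
    exact minpoly.dvd F x hxh
  refine isUnit_of_dvd_one ((mul_dvd_mul_iff_right ?_).1 hdvd)
  rintro rfl
  exact minpoly.ne_zero hx (by rw [hh, mul_zero])

namespace QuadDatum

open Polynomial

variable {F : Type*} [Field F] (D : QuadDatum F)

theorem isIntegral_a : IsIntegral F D.a := Algebra.IsIntegral.isIntegral _

theorem τ_aeval_a (p : F[X]) : D.τ (aeval D.a p) = aeval D.a (p.comp (-X)) := by
  have h : aeval (D.τ.restrictScalars F D.a) p = D.τ.restrictScalars F (aeval D.a p) :=
    aeval_algHom_apply (D.τ.restrictScalars F) D.a p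
  rw [aeval_comp, map_neg, aeval_X, ← D.τ_a]
  exact h.symm

theorem dvd_minpoly_comp_neg_X : minpoly F D.a ∣ (minpoly F D.a).comp (-X) := by
  refine minpoly.dvd F D.a ?_
  rw [← τ_aeval_a, minpoly.aeval, map_zero]

theorem comp_neg_X_dvd_minpoly {g : F[X]} (hg : g ∣ minpoly F D.a) :
    g.comp (-X) ∣ minpoly F D.a := by
  have hcomp {p q : F[X]} : p ∣ q → p.comp (-X) ∣ q.comp (-X) := by
    rintro ⟨r, rfl⟩
    exact ⟨r.comp (-X), mul_comp _ _ _⟩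
  refine (hcomp hg).trans ?_
  simpa [comp_assoc] using hcomp D.dvd_minpoly_comp_neg_X

theorem squarefree_minpoly : Squarefree (minpoly F D.a) :=
  (minpoly.isRadical F D.a).squarefree (minpoly.ne_zero D.isIntegral_a)

/-- For a non-unit divisor `g`, the element `g(a) g(-a)` lies in the field `Fs` and is not a unit,
hence vanishes. -/
theorem minpoly_dvd_mul_comp_neg_X {g : F[X]} (hg : g ∣ minpoly F D.a) (hu : ¬ IsUnit g) :
    minpoly F D.a ∣ g * g.comp (-X) := by
  refine minpoly.dvd F D.a ?_
  have hfix : D.τ (aeval D.a (g * g.comp (-X))) = aeval D.a (g * g.comp (-X)) := by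
    rw [τ_aeval_a, mul_comp, comp_assoc]
    simp [mul_comm]
  obtain ⟨s, hs⟩ := (D.τ_fixed _).1 hfix
  by_cases h0 : s = 0
  · rw [← hs, h0, map_zero]
  · refine absurd (Polynomial.isUnit_of_dvd_minpoly_of_isUnit_aeval D.isIntegral_a hg ?_) hu
    have hunit : IsUnit (aeval D.a (g * g.comp (-X))) :=
      hs ▸ (isUnit_iff_ne_zero.2 h0).map (algebraMap D.Fs D.A)
    rw [map_mul] at hunit
    exact isUnit_of_mul_isUnit_left hunit

theorem minpoly_dvd_minpoly {D E : QuadDatum F} {g : F[X]} (hD : g ∣ minpoly F D.a)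
    (hE : g ∣ minpoly F E.a) (hu : ¬ IsUnit g) : minpoly F D.a ∣ minpoly F E.a := by
  refine (D.squarefree_minpoly.dvd_pow_iff_dvd two_ne_zero).1 ?_
  rw [sq]
  exact (D.minpoly_dvd_mul_comp_neg_X hD hu).trans (mul_dvd_mul hE (E.comp_neg_X_dvd_minpoly hE))

/-- The power basis of `A` generated by `a`. -/
noncomputable def powerBasis : PowerBasis F D.A := .ofAdjoinEqTop D.isIntegral_a D.a_gen

@[simp]
theorem powerBasis_gen : D.powerBasis.gen = D.a := PowerBasis.ofAdjoinEqTop_gen _ _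

theorem finrank_eq : Module.finrank F D.A = (minpoly F D.a).natDegree := by
  rw [D.powerBasis.finrank, ← PowerBasis.natDegree_minpoly, powerBasis_gen]

theorem isCoprime_minpoly {D E : QuadDatum F} (h : ∀ e : D.A ≃ₐ[F] E.A, e D.a ≠ E.a) :
    IsCoprime (minpoly F D.a) (minpoly F E.a) := by
  rw [← isRelPrime_iff_isCoprime]
  intro g hD hE
  by_contra hu
  have heq : minpoly F D.a = minpoly F E.a :=
    eq_of_monic_of_associated (minpoly.monic D.isIntegral_a) (minpoly.monic E.isIntegral_a)
      (associated_of_dvd_dvd (minpoly_dvd_minpoly hD hE hu) (minpoly_dvd_minpoly hE hD hu))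
  refine h (D.powerBasis.equivOfMinpoly E.powerBasis (by simpa using heq)) ?_
  simpa using D.powerBasis.equivOfMinpoly_gen E.powerBasis (by simpa using heq)

end QuadDatum

open Polynomial in
theorem charpoly_eq_prod_minpoly {F : Type*} [Field F] {I : Type*} [Fintype I] [DecidableEq I]
    (D : I → QuadDatum F)
    (hcop : Pairwise (Function.onFun IsCoprime fun i ↦ minpoly F (D i).a))
    (XW : Module.End F (∀ i, (D i).A))
    (hXW : ∀ (v : ∀ i, (D i).A) (i : I), XW v i = (D i).a * v i) :
    XW.charpoly = ∏ i, minpoly F (D i).a := by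
  have haeval (p : F[X]) (v : ∀ i, (D i).A) (i : I) :
      aeval XW p v i = aeval (D i).a p * v i := by
    induction p using Polynomial.induction_on' generalizing v with
    | add p q hp hq => simp [hp, hq, add_mul]
    | monomial n c =>
      have hpow : (XW ^ n) v i = (D i).a ^ n * v i := by
        induction n generalizing v with
        | zero => simp
        | succ n ih => rw [pow_succ, Module.End.mul_apply, ih, hXW, pow_succ, mul_assoc]
      simp [aeval_monomial, hpow, Algebra.smul_def, mul_assoc]
  refine eq_of_monic_of_dvd_of_natDegree_le
    (monic_prod_of_monic _ _ fun i _ ↦ minpoly.monic (D i).isIntegral_a) XW.charpoly_monic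
    (Finset.prod_dvd_of_coprime (hcop.set_pairwise _) fun i _ ↦ minpoly.dvd F _ ?_) (le_of_eq ?_)
  · simpa [XW.aeval_self_charpoly] using (haeval XW.charpoly 1 i).symm
  · rw [XW.charpoly_natDegree, Module.finrank_pi_fintype,
      natDegree_prod_of_monic _ _ fun i _ ↦ minpoly.monic (D i).isIntegral_a]
    exact Finset.sum_congr rfl fun i _ ↦ (D i).finrank_eq

/-- With `W = ⊕_i F_i` and `X_W` acting by multiplication by `a_i` on
each summand `F_i`, the characteristic polynomial of `X_W` is squarefree (`X_W` has
pairwise distinct eigenvalues in an algebraic closure) and has nonzero constant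
coefficient (`X_W` is invertible). -/
theorem stmt_8 (F : Type*) [Field F] [CharZero F]
    (I : Type*) [Fintype I] [DecidableEq I] (D : I → QuadDatum F)
    (hdist : ∀ i j : I, i ≠ j → ∀ e : (D i).A ≃ₐ[F] (D j).A, e (D i).a ≠ (D j).a)
    (XW : Module.End F (∀ i, (D i).A))
    (hXW : ∀ (v : ∀ i, (D i).A) (i : I), XW v i = (D i).a * v i) :
    Squarefree (LinearMap.charpoly XW) ∧ (LinearMap.charpoly XW).coeff 0 ≠ 0 := by
  have hcop : Pairwise (Function.onFun IsCoprime fun i ↦ minpoly F (D i).a) :=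
    fun i j hij ↦ QuadDatum.isCoprime_minpoly (hdist i j hij)
  constructor
  · rw [charpoly_eq_prod_minpoly D hcop XW hXW]
    exact Finset.squarefree_prod_of_pairwise_isCoprime
      (fun i _ j _ hij ↦ (hcop hij).isRelPrime) fun i _ ↦ (D i).squarefree_minpoly
  · intro h0
    have hker : LinearMap.ker XW = ⊥ := by
      refine (LinearMap.ker_eq_bot').2 fun v hv ↦ funext fun i ↦ ?_
      rw [Pi.zero_apply, ← (D i).a_unit.mul_right_eq_zero, ← hXW, hv, Pi.zero_apply]
    have hdet := (LinearMap.isUnit_det XW ((LinearMap.isUnit_iff_ker_eq_bot XW).2 hker)).ne_zero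
    rw [LinearMap.det_eq_sign_charpoly_coeff, h0, mul_zero] at hdet
    exact hdet rfl
end

section
/- Let (I, (F_i^#), (F_i), (τ_i), (a_i), (c_i), W, q_W, X_W) and (I', (F'^#_{i'}), (F'_{i'}), (τ'_{i'}), (a'_{i'}), (c'_{i'}), W', q_{W'}, X_{W'}) be two instances of the data described in the context. Suppose there exist a bijection φ : I → I' and, for each i ∈ I, an F-algebra isomorphism σ_i : F'_{φ(i)} → F_i with σ_i(a'_{φ(i)}) = a_i, and suppose moreover that for every i ∈ I there exists x_i ∈ F_i^× with c_i·σ_i(c'_{φ(i)})^{-1} = x_i·τ_i(x_i). Then there exists an F-linear bijection g : W' → W satisfying q_W(g v, g w) = q_{W'}(v, w) for all v, w ∈ W' and g ∘ X_{W'} = X_W ∘ g. -/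
open scoped TensorProduct

theorem QuadDatum.algEquiv_comp_τ {F : Type*} [Field F] (D D' : QuadDatum F)
    (e : D'.A ≃ₐ[F] D.A) (he : e D'.a = D.a) (y : D'.A) : e (D'.τ y) = D.τ (e y) := by
  have h : e.toAlgHom.comp (D'.τ.restrictScalars F).toAlgHom =
      (D.τ.restrictScalars F).toAlgHom.comp e.toAlgHom := by
    refine AlgHom.ext_of_adjoin_eq_top D'.a_gen ?_
    rintro _ rfl
    simp [D.τ_a, D'.τ_a, he]
  exact DFunLike.congr_fun h y

/-- For two instances of the data (spaces `W`, `W'` with forms `q_W`,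
`q_{W'}` and endomorphisms `X_W`, `X_{W'}`), if there are a bijection `φ : I → I'` and
`F`-algebra isomorphisms `σ_i : F'_{φ(i)} → F_i` with `σ_i(a'_{φ(i)}) = a_i` such that
moreover for every `i` there is `x_i ∈ F_i^×` with
`c_i·σ_i(c'_{φ(i)})⁻¹ = x_i·τ_i(x_i)` (i.e. `c_i = x_i·τ_i(x_i)·σ_i(c'_{φ(i)})`), then
there is an `F`-linear bijection `g : W' → W` with `q_W(g v, g w) = q_{W'}(v, w)` for all
`v, w` and `g ∘ X_{W'} = X_W ∘ g`. -/
theorem stmt_11 (F : Type*) [Field F] [CharZero F]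
    (I : Type*) [Fintype I] (D : I → QuadDatum F)
    (hdist : ∀ i j : I, i ≠ j → ∀ e : (D i).A ≃ₐ[F] (D j).A, e (D i).a ≠ (D j).a)
    (I' : Type*) [Fintype I'] (D' : I' → QuadDatum F)
    (hdist' : ∀ i j : I', i ≠ j → ∀ e : (D' i).A ≃ₐ[F] (D' j).A, e (D' i).a ≠ (D' j).a)
    (qW : (∀ i, (D i).A) → (∀ i, (D i).A) → F)
    (hqW : ∀ v w : ∀ i, (D i).A, qW v w =
      ∑ i, (Module.finrank F (D i).A : F)⁻¹ *
        Algebra.trace F (D i).A ((D i).τ (v i) * w i * (D i).c))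
    (qW' : (∀ i', (D' i').A) → (∀ i', (D' i').A) → F)
    (hqW' : ∀ v w : ∀ i', (D' i').A, qW' v w =
      ∑ i', (Module.finrank F (D' i').A : F)⁻¹ *
        Algebra.trace F (D' i').A ((D' i').τ (v i') * w i' * (D' i').c))
    (XW : Module.End F (∀ i, (D i).A))
    (hXW : ∀ (v : ∀ i, (D i).A) (i : I), XW v i = (D i).a * v i)
    (XW' : Module.End F (∀ i', (D' i').A))
    (hXW' : ∀ (v : ∀ i', (D' i').A) (i' : I'), XW' v i' = (D' i').a * v i')
    (hmatch : ∃ φ : I ≃ I', ∀ i : I,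
      ∃ e : (D' (φ i)).A ≃ₐ[F] (D i).A, e (D' (φ i)).a = (D i).a ∧
        ∃ x : (D i).A, IsUnit x ∧ (D i).c = x * (D i).τ x * e (D' (φ i)).c) :
    ∃ g : (∀ i', (D' i').A) ≃ₗ[F] (∀ i, (D i).A),
      (∀ v w : ∀ i', (D' i').A, qW (g v) (g w) = qW' v w) ∧
      (∀ v : ∀ i', (D' i').A, g (XW' v) = XW (g v)) := by
  obtain ⟨φ, hφ⟩ := hmatch
  choose e he x hx hc using hφ
  let u (i : I) : (D i).Aˣ := (hx i).unit
  have hu (i : I) : (u i : (D i).A) = x i := (hx i).unit_spec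
  let g : (∀ i', (D' i').A) ≃ₗ[F] (∀ i, (D i).A) :=
    (LinearEquiv.piCongrLeft F (fun i' => (D' i').A) φ).symm ≪≫ₗ
      LinearEquiv.piCongrRight fun i =>
        (e i).toLinearEquiv ≪≫ₗ DistribMulAction.toLinearEquiv F (D i).A (u i)⁻¹
  have hg (v : ∀ i', (D' i').A) (i : I) : g v i = ↑(u i)⁻¹ * e i (v (φ i)) := rfl
  refine ⟨g, fun v w => ?_, fun v => ?_⟩
  · rw [hqW, hqW', ← φ.sum_comp]
    refine Finset.sum_congr rfl fun i _ => ?_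
    have h₁ : (↑(u i)⁻¹ : (D i).A) * x i = 1 := by rw [← hu, Units.inv_mul]
    have h₂ : (D i).τ ↑(u i)⁻¹ * (D i).τ (x i) = 1 := by rw [← map_mul, h₁, map_one]
    have h : (D i).τ (g v i) * g w i * (D i).c =
        e i ((D' (φ i)).τ (v (φ i)) * w (φ i) * (D' (φ i)).c) := by
      rw [hg, hg, hc i, map_mul, map_mul, map_mul, QuadDatum.algEquiv_comp_τ _ _ _ (he i)]
      linear_combination (D i).τ (e i (v (φ i))) * e i (w (φ i)) * e i (D' (φ i)).c *
        ((D i).τ ↑(u i)⁻¹ * (D i).τ (x i) * h₁ + h₂)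
    rw [h, Algebra.trace_eq_of_algEquiv, (e i).toLinearEquiv.finrank_eq]
  · ext i
    rw [hXW, hg, hg, hXW', map_mul, he]
    ring
end

section
/- With F, F̄, Γ_F, F^# ⊆ F_0, τ_0, ι, Σ(F_0) and G_0 as in the context: (1) the formula (ζ·y)(σ) = ζ(y(ζ^{-1}∘σ)) defines an action of Γ_F on G_0 by group automorphisms; and (2) the evaluation map y ↦ y(ι) is a group isomorphism from the subgroup of Γ_F-fixed points of G_0 onto ι({z ∈ F_0^× : z·τ_0(z) = 1}). -/
/-- Over an algebraic closure `K` of `F`, the group of `F`-automorphisms of `K` acts transitively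
on the embeddings into `K` of an algebraic extension of `F`. -/
theorem exists_algEquiv_comp_eq {F K E : Type*} [Field F] [Field K] [Algebra F K]
    [IsAlgClosure F K] [Field E] [Algebra F E] (ι σ : E →ₐ[F] K) :
    ∃ ζ : K ≃ₐ[F] K, (ζ : K →ₐ[F] K).comp ι = σ := by
  have : IsAlgClosed K := IsAlgClosure.isAlgClosed F
  have : Algebra.IsAlgebraic F K := IsAlgClosure.isAlgebraic
  let : Algebra E K := ι.toRingHom.toAlgebra
  have : IsScalarTower F E K := IsScalarTower.of_algebraMap_eq fun x => (ι.commutes x).symm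
  have : Algebra.IsAlgebraic E K := Algebra.IsAlgebraic.tower_top (K := F) E
  obtain ⟨f, hf⟩ := IsAlgClosed.surjective_domRestrict_of_isAlgebraic (K := F) (L := E) (E := K) σ
  refine ⟨AlgEquiv.ofBijective f (Algebra.IsAlgebraic.algHom_bijective f), ?_⟩
  ext x
  exact DFunLike.congr_fun hf x

/-- In characteristic zero, an element of an algebraic closure `K` of `F` fixed by every
`F`-automorphism of `K` that fixes the image of an embedding `ι` lies in that image. -/
theorem exists_eq_of_forall_algEquiv_fixed {F K E : Type*} [Field F] [CharZero F] [Field K]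
    [Algebra F K] [IsAlgClosure F K] [Field E] [Algebra F E] (ι : E →ₐ[F] K) (x : K)
    (hx : ∀ ζ : K ≃ₐ[F] K, (ζ : K →ₐ[F] K).comp ι = ι → ζ x = x) : ∃ z : E, ι z = x := by
  have : IsAlgClosed K := IsAlgClosure.isAlgClosed F
  have : Algebra.IsAlgebraic F K := IsAlgClosure.isAlgebraic
  let : Algebra E K := ι.toRingHom.toAlgebra
  have : IsScalarTower F E K := IsScalarTower.of_algebraMap_eq fun x => (ι.commutes x).symm
  have : Algebra.IsAlgebraic E K := Algebra.IsAlgebraic.tower_top (K := F) E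
  have : CharZero E := charZero_of_injective_algebraMap (algebraMap F E).injective
  have : IsAlgClosure E K := ⟨inferInstance, inferInstance⟩
  have : Normal E K := IsAlgClosure.normal E K
  have : IsGalois E K := ⟨⟩
  refine (InfiniteGalois.mem_range_algebraMap_iff_fixed (k := E) x).2 fun f => ?_
  exact hx (f.restrictScalars F) (AlgHom.ext fun z => f.commutes z)

/-- `F` a field of characteristic zero with algebraic closure `K` and
absolute Galois group `Γ_F = (K ≃ₐ[F] K)`; `Fs = F^# ⊆ F0` finite extensions of `F` with
`[F0 : Fs] = 2`, `τ0` the nontrivial `Fs`-automorphism of `F0`, `ι : F0 → K` the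
inclusion; `G0` the group (under pointwise multiplication) of functions
`y : Σ(F0) → K^×` with `y(σ)·y(σ∘τ0) = 1` for all `σ ∈ Σ(F0) = Hom_F(F0, K)`.  Then
(1) `(ζ·y)(σ) = ζ(y(ζ⁻¹∘σ))` defines an action of `Γ_F` on `G0` by group automorphisms,
and (2) evaluation `y ↦ y(ι)` is a group isomorphism from the `Γ_F`-fixed points of `G0`
onto `ι({z ∈ F0^× : z·τ0(z) = 1})`. -/
theorem stmt_12 (F : Type*) [Field F] [CharZero F]
    (K : Type*) [Field K] [Algebra F K] [IsAlgClosure F K]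
    (Fs F0 : Type*) [Field Fs] [Field F0]
    [Algebra F Fs] [Algebra Fs F0] [Algebra F F0] [IsScalarTower F Fs F0]
    [FiniteDimensional F F0]
    (hrank : Module.finrank Fs F0 = 2)
    (τ0 : F0 ≃ₐ[Fs] F0) (hτ0 : τ0 ≠ AlgEquiv.refl)
    (ι : F0 →ₐ[F] K)
    (τF : F0 →ₐ[F] F0) (hτF : ∀ x : F0, τF x = τ0 x)
    (G0 : Set ((F0 →ₐ[F] K) → K))
    (hG0 : G0 = {y | ∀ σ : F0 →ₐ[F] K, y σ * y (σ.comp τF) = 1})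
    (act : (K ≃ₐ[F] K) → ((F0 →ₐ[F] K) → K) → ((F0 →ₐ[F] K) → K))
    (hact : ∀ (ζ : K ≃ₐ[F] K) (y : (F0 →ₐ[F] K) → K) (σ : F0 →ₐ[F] K),
      act ζ y σ = ζ (y (((ζ⁻¹ : K ≃ₐ[F] K) : K →ₐ[F] K).comp σ))) :
    (∀ ζ : K ≃ₐ[F] K, ∀ y ∈ G0, act ζ y ∈ G0) ∧
    (∀ (ζ : K ≃ₐ[F] K) (y y' : (F0 →ₐ[F] K) → K), act ζ (y * y') = act ζ y * act ζ y') ∧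
    (∀ (ζ η : K ≃ₐ[F] K) (y : (F0 →ₐ[F] K) → K), act (ζ * η) y = act ζ (act η y)) ∧
    (∀ y : (F0 →ₐ[F] K) → K, act 1 y = y) ∧
    (∀ y y' : (F0 →ₐ[F] K) → K, (y * y') ι = y ι * y' ι) ∧
    Set.BijOn (fun y : (F0 →ₐ[F] K) → K => y ι)
      {y | y ∈ G0 ∧ ∀ ζ : K ≃ₐ[F] K, act ζ y = y}
      {x : K | ∃ z : F0, z * τ0 z = 1 ∧ x = ι z} := by
  subst hG0
  refine ⟨fun ζ y hy σ => ?_, fun ζ y y' => ?_, fun ζ η y => ?_, fun y => ?_, fun y y' => rfl,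
    ?_, ?_, ?_⟩
  · rw [hact, hact, ← map_mul, ← AlgHom.comp_assoc, hy, map_one]
  · ext σ
    simp [hact]
  · ext σ
    simp only [hact, AlgEquiv.mul_apply]
    congr 3
  · ext σ
    rw [hact]
    simp only [AlgEquiv.one_apply]
    congr 1
  all_goals
    have key : ∀ y : (F0 →ₐ[F] K) → K, (∀ ζ : K ≃ₐ[F] K, act ζ y = y) →
        ∀ (ζ : K ≃ₐ[F] K) (σ : F0 →ₐ[F] K), y ((ζ : K →ₐ[F] K).comp σ) = ζ (y σ) := by
      intro y hy ζ σ
      have h := congrFun (hy ζ) ((ζ : K →ₐ[F] K).comp σ)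
      rw [hact] at h
      rw [← h]
      congr 2
      ext x
      exact ζ.symm_apply_apply _
  · rintro y ⟨hyG, hy⟩
    obtain ⟨z, hz⟩ := exists_eq_of_forall_algEquiv_fixed ι (y ι) fun ζ hζ => by
      rw [← key y hy, hζ]
    obtain ⟨ζ, hζ⟩ := exists_algEquiv_comp_eq ι (ι.comp τF)
    refine ⟨z, (ι : F0 →+* K).injective ?_, hz.symm⟩
    have h := hyG ι
    rw [← hζ, key y hy, ← hz] at h
    have h' : ζ (ι z) = ι (τ0 z) := by
      rw [← hτF]
      exact DFunLike.congr_fun hζ z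
    rw [map_mul, map_one]
    exact (congrArg (ι z * ·) h'.symm).trans h
  · rintro y ⟨-, hy⟩ y' ⟨-, hy'⟩ h
    ext σ
    obtain ⟨ζ, rfl⟩ := exists_algEquiv_comp_eq ι σ
    rw [key y hy, key y' hy']
    exact congrArg ζ h
  · rintro _ ⟨z, hz, rfl⟩
    refine ⟨fun σ => σ z, ⟨fun σ => ?_, fun ζ => ?_⟩, rfl⟩
    · change σ z * σ (τF z) = 1
      rw [hτF, ← map_mul, hz, map_one]
    · ext σ
      rw [hact]
      exact ζ.apply_symm_apply _
end

section
/- With F, F̄, Γ_F, F^# ⊆ F_0, τ_0, ι, Σ(F_0) and G_0 as in the context, let τ ↦ y_τ be a 1-cocycle of Γ_F in G_0 (i.e. y_{στ} = y_σ·(σ·y_τ) for all σ, τ ∈ Γ_F) and let z ∈ F̄^× satisfy y_τ(ι) = τ(z)·z^{-1} for every τ ∈ Γ_F with τ∘ι = ι. Then for any two elements θ_1, θ_2 ∈ Γ_F with θ_1∘ι = θ_2∘ι = ι∘τ_0, one has y_{θ_1}(ι)·z·θ_1(z) = y_{θ_2}(ι)·z·θ_2(z). -/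
/-- With the setup of Statement 12 (`K` an algebraic closure of `F`,
`Fs ⊆ F0` with `[F0:Fs] = 2`, involution `τ0`, embedding `ι`, group `G0` with the
Galois action `act`), let `τ ↦ y_τ` be a 1-cocycle of `Γ_F = (K ≃ₐ[F] K)` in `G0` and
let `z ∈ K^×` satisfy `y_τ(ι) = τ(z)·z⁻¹` for every `τ` with `τ∘ι = ι`.  Then for any
`θ₁, θ₂ ∈ Γ_F` with `θ₁∘ι = θ₂∘ι = ι∘τ0`, one has
`y_{θ₁}(ι)·z·θ₁(z) = y_{θ₂}(ι)·z·θ₂(z)`. -/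
theorem stmt_13 (F : Type*) [Field F] [CharZero F]
    (K : Type*) [Field K] [Algebra F K] [IsAlgClosure F K]
    (Fs F0 : Type*) [Field Fs] [Field F0]
    [Algebra F Fs] [Algebra Fs F0] [Algebra F F0] [IsScalarTower F Fs F0]
    [FiniteDimensional F F0]
    (hrank : Module.finrank Fs F0 = 2)
    (τ0 : F0 ≃ₐ[Fs] F0) (hτ0 : τ0 ≠ AlgEquiv.refl)
    (ι : F0 →ₐ[F] K)
    (τF : F0 →ₐ[F] F0) (hτF : ∀ x : F0, τF x = τ0 x)
    (G0 : Set ((F0 →ₐ[F] K) → K))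
    (hG0 : G0 = {y | ∀ σ : F0 →ₐ[F] K, y σ * y (σ.comp τF) = 1})
    (act : (K ≃ₐ[F] K) → ((F0 →ₐ[F] K) → K) → ((F0 →ₐ[F] K) → K))
    (hact : ∀ (ζ : K ≃ₐ[F] K) (y : (F0 →ₐ[F] K) → K) (σ : F0 →ₐ[F] K),
      act ζ y σ = ζ (y (((ζ⁻¹ : K ≃ₐ[F] K) : K →ₐ[F] K).comp σ)))
    (yc : (K ≃ₐ[F] K) → (F0 →ₐ[F] K) → K)
    (hyc : ∀ t : K ≃ₐ[F] K, yc t ∈ G0)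
    (hcoc : ∀ s t : K ≃ₐ[F] K, yc (s * t) = yc s * act s (yc t))
    (z : K) (hz0 : z ≠ 0)
    (hz : ∀ t : K ≃ₐ[F] K, (t : K →ₐ[F] K).comp ι = ι → yc t ι = t z * z⁻¹)
    (θ₁ θ₂ : K ≃ₐ[F] K)
    (hθ₁ : (θ₁ : K →ₐ[F] K).comp ι = ι.comp τF)
    (hθ₂ : (θ₂ : K →ₐ[F] K).comp ι = ι.comp τF) :
    yc θ₁ ι * z * θ₁ z = yc θ₂ ι * z * θ₂ z := by
  set t : K ≃ₐ[F] K := θ₁⁻¹ * θ₂ with ht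
  have hθ : θ₁ * t = θ₂ := by simp [ht]
  have hinv : ∀ x, θ₁⁻¹ (θ₁ x) = x := θ₁.symm_apply_apply
  have hθ₁x : ∀ x, θ₁ (ι x) = ι (τF x) := fun x => DFunLike.congr_fun hθ₁ x
  have hθ₂x : ∀ x, θ₂ (ι x) = ι (τF x) := fun x => DFunLike.congr_fun hθ₂ x
  have htι : (t : K →ₐ[F] K).comp ι = ι := by
    ext x
    change θ₁⁻¹ (θ₂ (ι x)) = ι x
    rw [hθ₂x, ← hθ₁x, hinv]
  have hσ : (((θ₁⁻¹ : K ≃ₐ[F] K) : K →ₐ[F] K).comp ι).comp τF = ι := by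
    ext x
    change θ₁⁻¹ (ι (τF x)) = ι x
    rw [← hθ₁x, hinv]
  have hG := hyc t
  rw [hG0] at hG
  have hy := hG (((θ₁⁻¹ : K ≃ₐ[F] K) : K →ₐ[F] K).comp ι)
  rw [hσ, hz t htι] at hy
  have hy' := congrArg θ₁ hy
  have htz : θ₁ (t z) = θ₂ z := by rw [← hθ]; rfl
  rw [map_mul, map_mul, map_inv₀, map_one, htz] at hy'
  have hc := congrFun (hcoc θ₁ t) ι
  rw [hθ, Pi.mul_apply, hact] at hc
  have hz₁ : θ₁ z ≠ 0 := by simpa using hz0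
  rw [hc]
  field_simp at hy'
  linear_combination (-(yc θ₁ ι * z)) * hy'
end

section
/- With F, F̄, Γ_F, F^# ⊆ F_0, τ_0, ι, Σ(F_0) and G_0 as in the context, let τ ↦ y_τ be a 1-cocycle of Γ_F in G_0, let z ∈ F̄^× satisfy y_τ(ι) = τ(z)·z^{-1} for every τ ∈ Γ_F with τ∘ι = ι, let θ ∈ Γ_F satisfy θ∘ι = ι∘τ_0, and set ỹ = y_θ(ι)·z·θ(z). Then σ(ỹ) = ỹ for every σ ∈ Γ_F fixing ι(F^#) pointwise; consequently ỹ lies in ι((F^#)^×). -/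
/-- A separable quadratic extension has exactly two embeddings into an algebraically closed field:
any embedding is one of two given distinct ones. -/
theorem AlgHom.eq_or_eq_of_finrank_eq_two {k L K : Type*} [Field k] [Field L] [Field K]
    [Algebra k L] [Algebra k K] [IsAlgClosed K] [Algebra.IsSeparable k L]
    (h2 : Module.finrank k L = 2) {f g : L →ₐ[k] K} (hfg : f ≠ g) (h : L →ₐ[k] K) :
    h = f ∨ h = g := by
  classical
  have : FiniteDimensional k L := Module.finite_of_finrank_eq_succ h2
  have hcard : Fintype.card (L →ₐ[k] K) = 2 := (AlgHom.card k L K).trans h2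
  have huniv : ({f, g} : Finset (L →ₐ[k] K)) = Finset.univ := by
    rw [← Finset.card_eq_iff_eq_univ, hcard, Finset.card_pair hfg]
  simpa [← huniv] using Finset.mem_univ h

/-- With the setup of Statements 12–13, let `τ ↦ y_τ` be a 1-cocycle
of `Γ_F` in `G0`, `z ∈ K^×` with `y_τ(ι) = τ(z)·z⁻¹` whenever `τ∘ι = ι`, and
`θ ∈ Γ_F` with `θ∘ι = ι∘τ0`; set `ỹ = y_θ(ι)·z·θ(z)`.  Then `σ(ỹ) = ỹ` for every
`σ ∈ Γ_F` fixing `ι(Fs)` pointwise; consequently `ỹ ∈ ι((Fs)^×)`. -/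
theorem stmt_14 (F : Type*) [Field F] [CharZero F]
    (K : Type*) [Field K] [Algebra F K] [IsAlgClosure F K]
    (Fs F0 : Type*) [Field Fs] [Field F0]
    [Algebra F Fs] [Algebra Fs F0] [Algebra F F0] [IsScalarTower F Fs F0]
    [FiniteDimensional F F0]
    (hrank : Module.finrank Fs F0 = 2)
    (τ0 : F0 ≃ₐ[Fs] F0) (hτ0 : τ0 ≠ AlgEquiv.refl)
    (ι : F0 →ₐ[F] K)
    (τF : F0 →ₐ[F] F0) (hτF : ∀ x : F0, τF x = τ0 x)
    (G0 : Set ((F0 →ₐ[F] K) → K))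
    (hG0 : G0 = {y | ∀ σ : F0 →ₐ[F] K, y σ * y (σ.comp τF) = 1})
    (act : (K ≃ₐ[F] K) → ((F0 →ₐ[F] K) → K) → ((F0 →ₐ[F] K) → K))
    (hact : ∀ (ζ : K ≃ₐ[F] K) (y : (F0 →ₐ[F] K) → K) (σ : F0 →ₐ[F] K),
      act ζ y σ = ζ (y (((ζ⁻¹ : K ≃ₐ[F] K) : K →ₐ[F] K).comp σ)))
    (yc : (K ≃ₐ[F] K) → (F0 →ₐ[F] K) → K)
    (hyc : ∀ t : K ≃ₐ[F] K, yc t ∈ G0)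
    (hcoc : ∀ s t : K ≃ₐ[F] K, yc (s * t) = yc s * act s (yc t))
    (z : K) (hz0 : z ≠ 0)
    (hz : ∀ t : K ≃ₐ[F] K, (t : K →ₐ[F] K).comp ι = ι → yc t ι = t z * z⁻¹)
    (θ : K ≃ₐ[F] K) (hθ : (θ : K →ₐ[F] K).comp ι = ι.comp τF) :
    (∀ σ : K ≃ₐ[F] K,
      (∀ x : Fs, σ (ι (algebraMap Fs F0 x)) = ι (algebraMap Fs F0 x)) →
      σ (yc θ ι * z * θ z) = yc θ ι * z * θ z) ∧
    ∃ w : Fs, w ≠ 0 ∧ yc θ ι * z * θ z = ι (algebraMap Fs F0 w) := by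
  have : IsAlgClosed K := IsAlgClosure.isAlgClosed F
  have : Algebra.IsAlgebraic F K := IsAlgClosure.isAlgebraic
  let _ : Algebra Fs K := ((ι : F0 →+* K).comp (algebraMap Fs F0)).toAlgebra
  have hmap (x : Fs) : algebraMap Fs K x = ι (algebraMap Fs F0 x) := rfl
  have : IsScalarTower F Fs K := IsScalarTower.of_algebraMap_eq fun x => by
    rw [hmap, ← IsScalarTower.algebraMap_apply, AlgHom.commutes]
  have : CharZero Fs := charZero_of_injective_algebraMap (algebraMap F Fs).injective
  have : FiniteDimensional Fs F0 := Module.finite_of_finrank_eq_succ hrank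
  have : Algebra.IsAlgebraic Fs K := Algebra.IsAlgebraic.tower_top (K := F) Fs
  have : IsAlgClosure Fs K := ⟨inferInstance, inferInstance⟩
  have : IsGalois Fs K := ⟨⟩
  -- the two embeddings of `F0` over `Fs`
  let ι' : F0 →ₐ[Fs] K := { (ι : F0 →+* K) with commutes' := fun x => rfl }
  have hne : ι' ≠ ι'.comp (τ0 : F0 →ₐ[Fs] F0) := fun h =>
    hτ0 <| AlgEquiv.ext fun x => (ι.injective (DFunLike.congr_fun h x)).symm
  have hττ (x : F0) : τ0 (τ0 x) = x := by
    rcases AlgHom.eq_or_eq_of_finrank_eq_two hrank hne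
      ((ι'.comp (τ0 : F0 →ₐ[Fs] F0)).comp (τ0 : F0 →ₐ[Fs] F0)) with h | h
    · exact ι.injective (DFunLike.congr_fun h x)
    · refine absurd ?_ hτ0
      ext y
      exact τ0.injective (ι.injective (DFunLike.congr_fun h y))
  have hθ' (x : F0) : θ (ι x) = ι (τ0 x) := by
    rw [← hτF]; exact DFunLike.congr_fun hθ x
  have hθinv : ((θ⁻¹ : K ≃ₐ[F] K) : K →ₐ[F] K).comp ι = ι.comp τF := by
    ext x
    change θ.symm (ι x) = ι (τF x)
    rw [AlgEquiv.symm_apply_eq, hθ', hτF, hττ]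
  have hmul (t : K ≃ₐ[F] K) : yc t ι * yc t (ι.comp τF) = 1 := by
    have := hyc t
    rw [hG0] at this
    exact this ι
  have hy0 (t : K ≃ₐ[F] K) : yc t ι ≠ 0 := left_ne_zero_of_mul_eq_one (hmul t)
  have hyτ (t : K ≃ₐ[F] K) : yc t (ι.comp τF) = (yc t ι)⁻¹ :=
    eq_inv_of_mul_eq_one_right (hmul t)
  have hθmul (t : K ≃ₐ[F] K) : yc (θ * t) ι = yc θ ι * (θ (yc t ι))⁻¹ := by
    rw [hcoc, Pi.mul_apply, hact, hθinv, hyτ, map_inv₀]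
  have ne0 (t : K ≃ₐ[F] K) {x : K} (hx : x ≠ 0) : t x ≠ 0 := (map_ne_zero t).2 hx
  have hfixθ : θ (yc θ ι * z * θ z) = yc θ ι * z * θ z := by
    have h := hz (θ * θ) (by
      ext x
      change θ (θ (ι x)) = ι x
      rw [hθ', hθ', hττ])
    rw [hθmul, AlgEquiv.mul_apply] at h
    have h1 := ne0 θ (hy0 θ)
    field_simp at h
    simp only [map_mul]
    linear_combination (-θ z) * h
  have hfixι (σ : K ≃ₐ[F] K) (hσ : ∀ x, σ (ι x) = ι x) :
      σ (yc θ ι * z * θ z) = yc θ ι * z * θ z := by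
    have hσι : (σ : K →ₐ[F] K).comp ι = ι := AlgHom.ext hσ
    have hσinv : ((σ⁻¹ : K ≃ₐ[F] K) : K →ₐ[F] K).comp ι = ι := by
      ext x
      change σ.symm (ι x) = ι x
      rw [AlgEquiv.symm_apply_eq, hσ]
    have hρ := hz (θ⁻¹ * σ * θ) (by
      ext x
      change θ.symm (σ (θ (ι x))) = ι x
      rw [AlgEquiv.symm_apply_eq, hθ', hσ])
    have h1 : yc (σ * θ) ι = σ z * z⁻¹ * σ (yc θ ι) := by
      rw [hcoc, Pi.mul_apply, hact, hσinv, hz σ hσι]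
    have h2 := hθmul (θ⁻¹ * σ * θ)
    have happ : θ ((θ⁻¹ * σ * θ) z) = σ (θ z) := θ.apply_symm_apply _
    rw [hρ, map_mul, map_inv₀, happ, ← mul_assoc, ← mul_assoc, mul_inv_cancel, one_mul, h1] at h2
    have hz1 := ne0 θ hz0
    have hz2 := ne0 σ hz1
    field_simp at h2
    simp only [map_mul]
    linear_combination h2
  have hfix (σ : K ≃ₐ[F] K)
      (hσ : ∀ x : Fs, σ (ι (algebraMap Fs F0 x)) = ι (algebraMap Fs F0 x)) :
      σ (yc θ ι * z * θ z) = yc θ ι * z * θ z := by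
    let σι : F0 →ₐ[Fs] K :=
      { (((σ : K →ₐ[F] K).comp ι : F0 →ₐ[F] K) : F0 →+* K) with commutes' := hσ }
    rcases AlgHom.eq_or_eq_of_finrank_eq_two hrank hne σι with h | h
    · exact hfixι σ fun x => DFunLike.congr_fun h x
    · have hρ := hfixι (θ⁻¹ * σ) fun x => by
        have hx : σ (ι x) = ι (τ0 x) := DFunLike.congr_fun h x
        change θ.symm (σ (ι x)) = ι x
        rw [AlgEquiv.symm_apply_eq, hx, hθ']
      have hρ' : θ.symm (σ (yc θ ι * z * θ z)) = yc θ ι * z * θ z := hρ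
      rw [AlgEquiv.symm_apply_eq] at hρ'
      rw [hρ', hfixθ]
  refine ⟨hfix, ?_⟩
  obtain ⟨w, hw⟩ := (InfiniteGalois.mem_range_algebraMap_iff_fixed
    (k := Fs) (yc θ ι * z * θ z)).2 fun σ =>
      hfix (σ.restrictScalars F) fun x => σ.commutes x
  refine ⟨w, ?_, hw.symm⟩
  rintro rfl
  rw [map_zero] at hw
  exact mul_ne_zero (mul_ne_zero (hy0 θ) hz0) (ne0 θ hz0) hw.symm
end

section
/- With F, F̄, Γ_F, F^# ⊆ F_0, τ_0, ι, Σ(F_0) and G_0 as in the context, let τ ↦ y_τ and τ ↦ y'_τ be 1-cocycles of Γ_F in G_0 which are cohomologous, i.e. there exists u ∈ G_0 with y'_τ = y_τ·(τ·u)·u^{-1} for all τ ∈ Γ_F. Let z, z' ∈ F̄^× satisfy y_τ(ι) = τ(z)·z^{-1} and y'_τ(ι) = τ(z')·z'^{-1} for every τ ∈ Γ_F with τ∘ι = ι, and let θ, θ' ∈ Γ_F satisfy θ∘ι = θ'∘ι = ι∘τ_0. Then there exists x ∈ F_0^× such that y'_{θ'}(ι)·z'·θ'(z') = y_θ(ι)·z·θ(z)·ι(x·τ_0(x)).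 -/
/-- An element of an algebraic closure fixed by every automorphism that fixes an embedding `ι`
of `L` pointwise lies in the image of `ι`. -/
theorem AlgHom.mem_range_of_forall_fixed {F L K : Type*} [Field F] [CharZero F] [Field L] [Field K]
    [Algebra F L] [Algebra F K] [IsAlgClosure F K] (ι : L →ₐ[F] K) {w : K}
    (hw : ∀ t : K ≃ₐ[F] K, (t : K →ₐ[F] K).comp ι = ι → t w = w) : ∃ x, ι x = w := by
  have : Algebra.IsAlgebraic F K := IsAlgClosure.isAlgebraic
  have : Normal F K := IsAlgClosure.normal F K
  have : IsGalois F K := ⟨⟩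
  have hmem : w ∈ IntermediateField.fixedField ι.fieldRange.fixingSubgroup := by
    rintro ⟨t, ht⟩
    refine hw t (AlgHom.ext fun a => ?_)
    exact (IntermediateField.mem_fixingSubgroup_iff _ _).1 ht (ι a) ⟨a, rfl⟩
  rwa [InfiniteGalois.fixedField_fixingSubgroup] at hmem

/-- Every automorphism of an extension of degree two is an involution. -/
theorem AlgEquiv.apply_apply_of_finrank_eq_two {E L : Type*} [Field E] [Field L] [Algebra E L]
    (h : Module.finrank E L = 2) (τ : L ≃ₐ[E] L) (x : L) : τ (τ x) = x := by
  have : FiniteDimensional E L := Module.finite_of_finrank_eq_succ h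
  have hcard : Nat.card (L ≃ₐ[E] L) ≤ 2 := by
    rw [Nat.card_eq_fintype_card, ← h]
    exact AlgEquiv.card_le
  have hpos : 0 < Nat.card (L ≃ₐ[E] L) := Nat.card_pos
  have hpow : τ ^ Nat.card (L ≃ₐ[E] L) = 1 := pow_card_eq_one'
  have hsq : τ ^ 2 = 1 := by
    obtain hc | hc : Nat.card (L ≃ₐ[E] L) = 1 ∨ Nat.card (L ≃ₐ[E] L) = 2 := by omega
    · rw [hc, pow_one] at hpow
      rw [hpow, one_pow]
    · rwa [hc] at hpow
  rw [pow_two] at hsq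
  exact DFunLike.congr_fun hsq x

/-- With the setup of Statements 12–14, let `τ ↦ y_τ` and `τ ↦ y'_τ`
be cohomologous 1-cocycles of `Γ_F` in `G0` (i.e. `y'_τ = y_τ·(τ·u)·u⁻¹` for some
`u ∈ G0`), let `z, z' ∈ K^×` satisfy `y_τ(ι) = τ(z)·z⁻¹` and `y'_τ(ι) = τ(z')·z'⁻¹`
whenever `τ∘ι = ι`, and let `θ, θ' ∈ Γ_F` satisfy `θ∘ι = θ'∘ι = ι∘τ0`.  Then there is
`x ∈ F0^×` with `y'_{θ'}(ι)·z'·θ'(z') = y_θ(ι)·z·θ(z)·ι(x·τ0(x))`. -/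
theorem stmt_15 (F : Type*) [Field F] [CharZero F]
    (K : Type*) [Field K] [Algebra F K] [IsAlgClosure F K]
    (Fs F0 : Type*) [Field Fs] [Field F0]
    [Algebra F Fs] [Algebra Fs F0] [Algebra F F0] [IsScalarTower F Fs F0]
    [FiniteDimensional F F0]
    (hrank : Module.finrank Fs F0 = 2)
    (τ0 : F0 ≃ₐ[Fs] F0) (hτ0 : τ0 ≠ AlgEquiv.refl)
    (ι : F0 →ₐ[F] K)
    (τF : F0 →ₐ[F] F0) (hτF : ∀ x : F0, τF x = τ0 x)
    (G0 : Set ((F0 →ₐ[F] K) → K))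
    (hG0 : G0 = {y | ∀ σ : F0 →ₐ[F] K, y σ * y (σ.comp τF) = 1})
    (act : (K ≃ₐ[F] K) → ((F0 →ₐ[F] K) → K) → ((F0 →ₐ[F] K) → K))
    (hact : ∀ (ζ : K ≃ₐ[F] K) (y : (F0 →ₐ[F] K) → K) (σ : F0 →ₐ[F] K),
      act ζ y σ = ζ (y (((ζ⁻¹ : K ≃ₐ[F] K) : K →ₐ[F] K).comp σ)))
    (yc yc' : (K ≃ₐ[F] K) → (F0 →ₐ[F] K) → K)
    (hyc : ∀ t : K ≃ₐ[F] K, yc t ∈ G0) (hyc' : ∀ t : K ≃ₐ[F] K, yc' t ∈ G0)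
    (hcoc : ∀ s t : K ≃ₐ[F] K, yc (s * t) = yc s * act s (yc t))
    (hcoc' : ∀ s t : K ≃ₐ[F] K, yc' (s * t) = yc' s * act s (yc' t))
    (u : (F0 →ₐ[F] K) → K) (hu : u ∈ G0)
    (hcob : ∀ t : K ≃ₐ[F] K, yc' t = yc t * act t u * u⁻¹)
    (z z' : K) (hz0 : z ≠ 0) (hz0' : z' ≠ 0)
    (hz : ∀ t : K ≃ₐ[F] K, (t : K →ₐ[F] K).comp ι = ι → yc t ι = t z * z⁻¹)
    (hz' : ∀ t : K ≃ₐ[F] K, (t : K →ₐ[F] K).comp ι = ι → yc' t ι = t z' * z'⁻¹)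
    (θ θ' : K ≃ₐ[F] K)
    (hθ : (θ : K →ₐ[F] K).comp ι = ι.comp τF)
    (hθ' : (θ' : K →ₐ[F] K).comp ι = ι.comp τF) :
    ∃ x : F0, x ≠ 0 ∧
      yc' θ' ι * z' * θ' z' = yc θ ι * z * θ z * ι (x * τ0 x) := by
  subst hG0
  have hinv_comp (t : K ≃ₐ[F] K) (σ ρ : F0 →ₐ[F] K) (h : (t : K →ₐ[F] K).comp σ = ρ) :
      ((t⁻¹ : K ≃ₐ[F] K) : K →ₐ[F] K).comp ρ = σ := by
    subst h
    ext a
    exact t.symm_apply_apply (σ a)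
  have hθι : ((θ⁻¹ : K ≃ₐ[F] K) : K →ₐ[F] K).comp ι = ι.comp τF := by
    refine hinv_comp θ _ _ (AlgHom.ext fun a => ?_)
    have h := DFunLike.congr_fun hθ (τF a)
    simp only [AlgHom.comp_apply] at h ⊢
    rw [h, hτF, hτF, AlgEquiv.apply_apply_of_finrank_eq_two hrank]
  have hu1 : u ι * u (ι.comp τF) = 1 := hu ι
  have hu0 : u ι ≠ 0 := left_ne_zero_of_mul_eq_one hu1
  obtain ⟨x, hx⟩ : ∃ x, ι x = z' * (z * u ι)⁻¹ := by
    refine AlgHom.mem_range_of_forall_fixed ι fun t ht => ?_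
    have h := congrFun (hcob t) ι
    simp only [Pi.mul_apply, Pi.inv_apply, hact, hinv_comp t ι ι ht, hz t ht, hz' t ht] at h
    have htz : t z ≠ 0 := (map_ne_zero t).2 hz0
    have htu : t (u ι) ≠ 0 := (map_ne_zero t).2 hu0
    simp only [map_mul, map_inv₀]
    field_simp at h ⊢
    linear_combination h
  have hx0 : x ≠ 0 := by
    rintro rfl
    rw [map_zero] at hx
    exact mul_ne_zero hz0' (inv_ne_zero (mul_ne_zero hz0 hu0)) hx.symm
  have hz'x : z' = z * u ι * ι x := by
    rw [hx]
    field_simp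
  have hθx : θ (ι x) = ι (τ0 x) := by
    have h := DFunLike.congr_fun hθ x
    simpa only [AlgHom.comp_apply, hτF] using! h
  have hcobθ : yc' θ ι = yc θ ι * (θ (u ι))⁻¹ * (u ι)⁻¹ := by
    have h := congrFun (hcob θ) ι
    simp only [Pi.mul_apply, Pi.inv_apply, hact, hθι] at h
    rw [h, eq_inv_of_mul_eq_one_right hu1, map_inv₀]
  have hindep : yc' θ' ι * θ' z' = yc' θ ι * θ z' := by
    have hs : ((θ⁻¹ * θ' : K ≃ₐ[F] K) : K →ₐ[F] K).comp ι = ι := by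
      exact (congrArg (AlgHom.comp ((θ⁻¹ : K ≃ₐ[F] K) : K →ₐ[F] K)) hθ').trans
        (hinv_comp θ _ _ hθ)
    have h := congrFun (hcoc' θ (θ⁻¹ * θ')) ι
    have hy : yc' (θ⁻¹ * θ') ι * yc' (θ⁻¹ * θ') (ι.comp τF) = 1 := hyc' _ ι
    rw [mul_inv_cancel_left, Pi.mul_apply, hact, hθι, eq_inv_of_mul_eq_one_right hy,
      hz' _ hs, map_inv₀, map_mul, map_inv₀, ← AlgEquiv.mul_apply, mul_inv_cancel_left] at h
    have hz1 : θ z' ≠ 0 := (map_ne_zero θ).2 hz0'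
    have hz2 : θ' z' ≠ 0 := (map_ne_zero θ').2 hz0'
    rw [h]
    field_simp
  refine ⟨x, hx0, ?_⟩
  have hθu : θ (u ι) ≠ 0 := (map_ne_zero θ).2 hu0
  calc yc' θ' ι * z' * θ' z' = yc' θ ι * θ z' * z' := by rw [← hindep]; ring
    _ = yc θ ι * z * θ z * ι (x * τ0 x) := by
      rw [hcobθ, hz'x, map_mul, map_mul, map_mul, hθx]
      field_simp
end

section
/- Let F be a field of characteristic zero and let L/F be a finite Galois extension. Let F^# ⊆ F_0 be intermediate fields of L/F with [F_0 : F^#] = 2, let τ_0 be the nontrivial F^#-algebra automorphism of F_0, and let ι : F_0 → L be the inclusion. Let Σ(F_0) be the set of F-algebra homomorphisms F_0 → L, and let G_0 be the group, under pointwise multiplication, of functions y : Σ(F_0) → L^× satisfying y(σ)·y(σ∘τ_0) = 1 for all σ, with Gal(L/F) acting by (ζ·y)(σ) = ζ(y(ζ^{-1}∘σ)). Let τ ↦ y_τ be a 1-cocycle of Gal(L/F) in G_0 (y_{στ} = y_σ·(σ·y_τ)), let z ∈ L^× satisfy y_τ(ι) = τ(z)·z^{-1} for every τ ∈ Gal(L/F)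 with τ∘ι = ι, and let θ ∈ Gal(L/F) satisfy θ∘ι = ι∘τ_0. If there exists x ∈ F_0^× with y_θ(ι)·z·θ(z) = ι(x·τ_0(x)), then the cocycle y is a coboundary: there exists u ∈ G_0 with y_τ = (τ·u)·u^{-1} for every τ ∈ Gal(L/F). -/
/-- Any `F`-embedding of a field `K` into a normal extension `L/F` is obtained from any other
one by an automorphism of `L/F`. -/
theorem exists_algEquiv_comp_eq_of_normal {F K L : Type*} [Field F] [Field K] [Field L]
    [Algebra F K] [Algebra F L] [Normal F L] (ι σ : K →ₐ[F] L) :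
    ∃ s : L ≃ₐ[F] L, (s : L →ₐ[F] L).comp ι = σ := by
  let e : ι.fieldRange ≃ₐ[F] σ.fieldRange :=
    (AlgEquiv.ofInjectiveField ι).symm.trans (AlgEquiv.ofInjectiveField σ)
  refine ⟨e.liftNormal L, AlgHom.ext fun x => ?_⟩
  have h := e.liftNormal_commutes L (AlgEquiv.ofInjectiveField ι x)
  have he : e (AlgEquiv.ofInjectiveField ι x) = AlgEquiv.ofInjectiveField σ x :=
    congrArg (AlgEquiv.ofInjectiveField σ) ((AlgEquiv.ofInjectiveField ι).symm_apply_apply x)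
  rw [he] at h
  exact h


/-- Let `L/F` be a finite Galois extension (char 0), `Fs ⊆ F0`
intermediate fields with `[F0 : Fs] = 2`, `τ0` the nontrivial `Fs`-automorphism of `F0`,
`ι : F0 → L` the inclusion, `G0` the group of `y : Hom_F(F0, L) → L` with
`y(σ)·y(σ∘τ0) = 1`, with `Gal(L/F)` acting by `(ζ·y)(σ) = ζ(y(ζ⁻¹∘σ))`.  If a 1-cocycle
`τ ↦ y_τ` of `Gal(L/F)` in `G0`, together with `z ∈ L^×` satisfying
`y_τ(ι) = τ(z)·z⁻¹` whenever `τ∘ι = ι`, and `θ` with `θ∘ι = ι∘τ0`, satisfies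
`y_θ(ι)·z·θ(z) = ι(x·τ0(x))` for some `x ∈ F0^×`, then the cocycle is a coboundary:
there is `u ∈ G0` with `y_τ = (τ·u)·u⁻¹` for every `τ`. -/
theorem stmt_16 (F : Type*) [Field F] [CharZero F]
    (L : Type*) [Field L] [Algebra F L] [FiniteDimensional F L] [IsGalois F L]
    (Fs F0 : Type*) [Field Fs] [Field F0]
    [Algebra F Fs] [Algebra Fs F0] [Algebra F F0] [IsScalarTower F Fs F0]
    [Algebra Fs L] [Algebra F0 L] [IsScalarTower F F0 L] [IsScalarTower Fs F0 L]
    [IsScalarTower F Fs L]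
    (hrank : Module.finrank Fs F0 = 2)
    (τ0 : F0 ≃ₐ[Fs] F0) (hτ0 : τ0 ≠ AlgEquiv.refl)
    (ι : F0 →ₐ[F] L) (hι : ∀ x : F0, ι x = algebraMap F0 L x)
    (τF : F0 →ₐ[F] F0) (hτF : ∀ x : F0, τF x = τ0 x)
    (G0 : Set ((F0 →ₐ[F] L) → L))
    (hG0 : G0 = {y | ∀ σ : F0 →ₐ[F] L, y σ * y (σ.comp τF) = 1})
    (act : (L ≃ₐ[F] L) → ((F0 →ₐ[F] L) → L) → ((F0 →ₐ[F] L) → L))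
    (hact : ∀ (ζ : L ≃ₐ[F] L) (y : (F0 →ₐ[F] L) → L) (σ : F0 →ₐ[F] L),
      act ζ y σ = ζ (y (((ζ⁻¹ : L ≃ₐ[F] L) : L →ₐ[F] L).comp σ)))
    (yc : (L ≃ₐ[F] L) → (F0 →ₐ[F] L) → L)
    (hyc : ∀ t : L ≃ₐ[F] L, yc t ∈ G0)
    (hcoc : ∀ s t : L ≃ₐ[F] L, yc (s * t) = yc s * act s (yc t))
    (z : L) (hz0 : z ≠ 0)
    (hz : ∀ t : L ≃ₐ[F] L, (t : L →ₐ[F] L).comp ι = ι → yc t ι = t z * z⁻¹)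
    (θ : L ≃ₐ[F] L) (hθ : (θ : L →ₐ[F] L).comp ι = ι.comp τF)
    (hnorm : ∃ x : F0, x ≠ 0 ∧ yc θ ι * z * θ z = ι (x * τ0 x)) :
    ∃ u ∈ G0, ∀ t : L ≃ₐ[F] L, yc t = act t u * u⁻¹ := by
  subst hG0
  obtain ⟨x, hx0, hx⟩ := hnorm
  have hιx : ι x ≠ 0 := (map_ne_zero ι).2 hx0
  have hmul (s t : L ≃ₐ[F] L) (σ : F0 →ₐ[F] L) :
      ((s * t : L ≃ₐ[F] L) : L →ₐ[F] L).comp σ =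
        (s : L →ₐ[F] L).comp ((t : L →ₐ[F] L).comp σ) := rfl
  have hinv (s : L ≃ₐ[F] L) (σ : F0 →ₐ[F] L) :
      ((s⁻¹ : L ≃ₐ[F] L) : L →ₐ[F] L).comp ((s : L →ₐ[F] L).comp σ) = σ :=
    AlgHom.ext fun a => s.symm_apply_apply (σ a)
  have hy0 (t : L ≃ₐ[F] L) (σ : F0 →ₐ[F] L) : yc t σ ≠ 0 :=
    left_ne_zero_of_mul_eq_one (hyc t σ)
  -- The cocycle relation, evaluated at a translated embedding.
  have hcoc' (s t : L ≃ₐ[F] L) (σ : F0 →ₐ[F] L) :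
      yc (s * t) ((s : L →ₐ[F] L).comp σ) = yc s ((s : L →ₐ[F] L).comp σ) * s (yc t σ) := by
    rw [hcoc, Pi.mul_apply, hact, hinv]
  set w : L := z * (ι x)⁻¹ with hw
  have hw0 : w ≠ 0 := mul_ne_zero hz0 (inv_ne_zero hιx)
  have hwt (t : L ≃ₐ[F] L) (ht : (t : L →ₐ[F] L).comp ι = ι) : t w = yc t ι * w := by
    have h1 : t (ι x) = ι x := DFunLike.congr_fun ht x
    rw [hz t ht, hw, map_mul, map_inv₀, h1]
    field_simp
  have hwθ : w * θ w * yc θ ι = 1 := by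
    have h1 : θ (ι x) = ι (τ0 x) := (DFunLike.congr_fun hθ x).trans (congrArg ι (hτF x))
    have h2 : ι (τ0 x) ≠ 0 := (map_ne_zero ι).2 ((map_ne_zero τ0).2 hx0)
    rw [hw, map_mul, map_inv₀, h1]
    rw [map_mul] at hx
    field_simp
    linear_combination hx
  choose lift hlift using exists_algEquiv_comp_eq_of_normal ι
  let u : (F0 →ₐ[F] L) → L := fun σ => lift σ w * (yc (lift σ) σ)⁻¹
  have hu (s : L ≃ₐ[F] L) :
      u ((s : L →ₐ[F] L).comp ι) = s w * (yc s ((s : L →ₐ[F] L).comp ι))⁻¹ := by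
    set σ := (s : L →ₐ[F] L).comp ι with hσ
    obtain ⟨t, ht⟩ : ∃ t, lift σ = s * t := ⟨s⁻¹ * lift σ, by group⟩
    have htι : (t : L →ₐ[F] L).comp ι = ι := by
      have h1 := hlift σ
      rw [ht, hmul] at h1
      rw [← hinv s ((t : L →ₐ[F] L).comp ι), h1, hσ, hinv]
    have h2 := hcoc' s t ι
    have h3 : s (yc t ι) ≠ 0 := (map_ne_zero s).2 (hy0 t ι)
    have h4 := hy0 s σ
    change lift σ w * (yc (lift σ) σ)⁻¹ = _
    rw [← hσ] at h2
    rw [ht, h2, AlgEquiv.mul_apply, hwt t htι, map_mul]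
    field_simp
  refine ⟨u, fun σ => ?_, fun t => funext fun σ => ?_⟩
  · obtain ⟨s, rfl⟩ := exists_algEquiv_comp_eq_of_normal ι σ
    have h1 : ((s : L →ₐ[F] L).comp ι).comp τF = ((s * θ : L ≃ₐ[F] L) : L →ₐ[F] L).comp ι := by
      rw [hmul, hθ, AlgHom.comp_assoc]
    have h2 := hyc s ((s : L →ₐ[F] L).comp ι)
    have h3 := congrArg s (hyc θ ι)
    have h4 := congrArg s hwθ
    have h5 := hcoc' s θ ((θ : L →ₐ[F] L).comp ι)
    rw [← hmul] at h5
    rw [h1] at h2 ⊢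
    rw [← hθ] at h3
    simp only [map_mul, map_one] at h3 h4
    rw [hu, hu, h5, AlgEquiv.mul_apply, mul_inv, ← eq_inv_of_mul_eq_one_left h3,
      mul_mul_mul_comm, ← mul_assoc (yc s _)⁻¹, ← mul_inv, h2, inv_one, one_mul, h4]
  · obtain ⟨s, rfl⟩ := exists_algEquiv_comp_eq_of_normal ι σ
    obtain ⟨r, rfl⟩ : ∃ r, s = t * r := ⟨t⁻¹ * s, by group⟩
    have h1 := hcoc' t r ((r : L →ₐ[F] L).comp ι)
    rw [← hmul] at h1
    have h2 : t (yc r ((r : L →ₐ[F] L).comp ι)) ≠ 0 := (map_ne_zero t).2 (hy0 r _)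
    have h3 := hy0 t (((t * r : L ≃ₐ[F] L) : L →ₐ[F] L).comp ι)
    have h4 : t (r w) ≠ 0 := (map_ne_zero t).2 ((map_ne_zero r).2 hw0)
    rw [Pi.mul_apply, Pi.inv_apply, hu, hact, h1, hmul t r ι, hinv, hu, AlgEquiv.mul_apply,
      map_mul, map_inv₀]
    rw [hmul] at h3
    field_simp
end

section
/- Let F be a field of characteristic zero, V an F-vector space of finite dimension d ≥ 1, and B a nondegenerate symmetric bilinear form on V. Write so(V, B) for the space of F-linear endomorphisms X of V with B(Xv, w) + B(v, Xw) = 0 for all v, w ∈ V. Then the following are equivalent: (i) there exists a nilpotent N ∈ so(V, B) whose centralizer {Y ∈ so(V, B) : N∘Y = Y∘N} has dimension 2⁻¹·d rounded down (i.e. ⌊d/2⌋), that is, so(V, B) contains a regular nilpotent element; (ii) there exists a subspace U ⊆ V of dimension ⌈d/2⌉ − 1 with B(u, u') = 0 for all u, u' ∈ U, i.e. the Witt index of B is at least ⌈d/2⌉ − 1 (the quadratic space (V, B) is quasi-split). -/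
/-- The centralizer of an endomorphism `N` inside the Lie algebra `so(V, B)` of
`B`-skew-adjoint endomorphisms, as a submodule of `End F V`. -/
def soCent (F V : Type*) [Field F] [AddCommGroup V] [Module F V]
    (B : V →ₗ[F] V →ₗ[F] F) (N : Module.End F V) : Submodule F (Module.End F V) where
  carrier := {Y | (∀ v w, B (Y v) w + B v (Y w) = 0) ∧ N * Y = Y * N}
  add_mem' := by
    rintro a b ⟨ha1, ha2⟩ ⟨hb1, hb2⟩
    refine ⟨fun v w => ?_, by rw [mul_add, add_mul, ha2, hb2]⟩
    have h1 := ha1 v w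
    have h2 := hb1 v w
    simp only [LinearMap.add_apply, map_add] at *
    linear_combination h1 + h2
  zero_mem' := by
    refine ⟨fun v w => ?_, by rw [mul_zero, zero_mul]⟩
    simp
  smul_mem' := by
    rintro t a ⟨ha1, ha2⟩
    refine ⟨fun v w => ?_, by rw [mul_smul_comm, smul_mul_assoc, ha2]⟩
    have h1 := ha1 v w
    simp only [LinearMap.smul_apply, map_smul, smul_eq_mul]
    linear_combination t * h1

section SkewEndomorphisms

open Module Submodule

variable {F V : Type*} [Field F] [AddCommGroup V] [Module F V]
  {B : V →ₗ[F] V →ₗ[F] F}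

theorem pow_skew {N : End F V} (hN : ∀ v w, B (N v) w + B v (N w) = 0)
    (k : ℕ) (v w : V) : B ((N ^ k) v) w = (-1) ^ k * B v ((N ^ k) w) := by
  induction k generalizing v w with
  | zero => simp
  | succ k ih =>
    rw [pow_succ, Module.End.mul_apply, ih, eq_neg_of_add_eq_zero_left (hN v _),
      ← Module.End.mul_apply, ← pow_succ', ← pow_succ]
    ring

theorem apply_self_eq_zero_of_skew [CharZero F] (hsymm : ∀ v w, B v w = B w v)
    {Y : End F V} (hY : ∀ v w, B (Y v) w + B v (Y w) = 0) (x : V) : B x (Y x) = 0 := by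
  have h := hY x x
  rw [hsymm, ← two_mul] at h
  simpa using h

theorem linearIndependent_pow_apply {N : End F V} {k : ℕ} {v : V}
    (hk : (N ^ (k + 1)) v = 0) (hv : (N ^ k) v ≠ 0) :
    LinearIndependent F fun i : Fin (k + 1) => (N ^ (i : ℕ)) v := by
  have hbig : ∀ n, k < n → (N ^ n) v = 0 := fun n hn => by
    obtain ⟨t, rfl⟩ := Nat.exists_eq_add_of_le' (Nat.succ_le_of_lt hn)
    rw [pow_add, Module.End.mul_apply, hk, map_zero]
  rw [Fintype.linearIndependent_iff]
  intro c hc i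
  induction i using WellFoundedLT.induction with
  | _ i ih =>
  have h := congrArg (N ^ (k - i)) hc
  rw [map_sum, map_zero, Finset.sum_eq_single i] at h
  · rw [map_smul, ← Module.End.mul_apply, ← pow_add, Nat.sub_add_cancel (by lia)] at h
    exact (smul_eq_zero.1 h).resolve_right hv
  · intro j _ hji
    rcases lt_or_gt_of_ne hji with hlt | hgt
    · simp [ih j hlt]
    · rw [map_smul, ← Module.End.mul_apply, ← pow_add, hbig _ (by have := Fin.lt_def.1 hgt; lia),
        smul_zero]
  · simp

theorem map_mem_of_mem_span {X : End F V} {s : Set V} {p : Submodule F V}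
    (h : ∀ x ∈ s, X x ∈ p) : ∀ z ∈ span F s, X z ∈ p :=
  fun _ hz => (span_le.2 h : span F s ≤ p.comap X) hz

theorem apply_eq_zero_of_mem_span {s : Set V} {y : V} (h : ∀ x ∈ s, B x y = 0) :
    ∀ z ∈ span F s, B z y = 0 :=
  fun _ hz => (span_le.2 h : span F s ≤ LinearMap.ker (B.flip y)) hz

theorem exists_submodule_le_finrank_eq {U : Submodule F V} {n : ℕ} (hn : n ≤ finrank F U) :
    ∃ U' ≤ U, finrank F U' = n := by
  obtain ⟨f, hf⟩ := exists_linearIndependent_of_le_finrank hn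
  refine ⟨span F (Set.range fun i => (f i : V)), ?_, ?_⟩
  · rw [span_le]
    rintro _ ⟨i, rfl⟩
    exact (f i).2
  · exact (finrank_span_eq_card (hf.map' U.subtype (ker_subtype U))).trans (Fintype.card_fin n)

/-- A symmetric form that separates points is nondegenerate. -/
theorem nondegenerate_of_symm (hsymm : ∀ v w, B v w = B w v)
    (hnd : ∀ v, (∀ w, B v w = 0) → v = 0) : LinearMap.BilinForm.Nondegenerate B :=
  ⟨hnd, fun y hy => hnd y fun w => by rw [hsymm, hy]⟩

/-- The centralizer of a skew nilpotent element is small as soon as the element has a Jordan block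
of codimension at most one. -/
theorem finrank_soCent_add_le [CharZero F] [FiniteDimensional F V]
    (hsymm : ∀ v w, B v w = B w v) (hnd : ∀ v, (∀ w, B v w = 0) → v = 0)
    {N : End F V} (hN : ∀ v w, B (N v) w + B v (N w) = 0) {r : ℕ} {v : V}
    (hr : (N ^ (2 * r + 1)) v = 0) (hv : (N ^ (2 * r)) v ≠ 0)
    (hdim : finrank F V ≤ 2 * r + 2) :
    finrank F (soCent F V B N) + (r + 1) ≤ finrank F V := by
  have hB := nondegenerate_of_symm hsymm hnd
  have hli := linearIndependent_pow_apply hr hv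
  have hcomm : ∀ Y ∈ soCent F V B N, ∀ (k : ℕ) x, Y ((N ^ k) x) = (N ^ k) (Y x) := by
    intro Y hY k x
    have : Commute (N ^ k) Y := Commute.pow_left hY.2 k
    exact (LinearMap.congr_fun this.eq x).symm
  let ev : soCent F V B N →ₗ[F] V := (LinearMap.applyₗ v) ∘ₗ (soCent F V B N).subtype
  have hev : ∀ Y, ev Y = Y.1 v := fun _ => rfl
  have hinj : Function.Injective ev := by
    rw [injective_iff_map_eq_zero]
    rintro ⟨Y, hY⟩ h0
    rw [hev] at h0
    ext x
    by_contra hx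
    change Y x ≠ 0 at hx
    let W := span F (Set.range fun i : Fin (2 * r + 1) => (N ^ (i : ℕ)) v)
    have hYW : ∀ z ∈ W, Y z = 0 := by
      intro z hz
      rw [← mem_bot F]
      refine map_mem_of_mem_span ?_ z hz
      rintro _ ⟨i, rfl⟩
      rw [hcomm Y hY, h0, map_zero, mem_bot]
    have hWdim : finrank F W = 2 * r + 1 := by
      rw [finrank_span_eq_card hli, Fintype.card_fin]
    have hxW : x ∉ W := fun h => hx (hYW x h)
    have hlt : W < W ⊔ span F {x} := by
      refine lt_of_le_of_ne le_sup_left fun h => hxW ?_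
      rw [h]
      exact mem_sup_right (mem_span_singleton_self x)
    have htop : W ⊔ span F {x} = ⊤ := by
      apply eq_top_of_finrank_eq
      have := finrank_lt_finrank_of_lt hlt
      have := finrank_le (W ⊔ span F {x})
      lia
    refine hx (hnd _ fun y => ?_)
    obtain ⟨z, hz, t, ht, rfl⟩ := mem_sup.1 (htop ▸ mem_top : y ∈ W ⊔ span F {x})
    obtain ⟨a, rfl⟩ := mem_span_singleton.1 ht
    have h1 : B (Y x) z = 0 := by
      have := hY.1 x z
      rwa [hYW z hz, map_zero, add_zero] at this
    rw [map_add, h1, map_smul, hsymm, apply_self_eq_zero_of_skew hsymm hY.1]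
    simp
  let W := span F (Set.range fun j : Fin (r + 1) => (N ^ (2 * (j : ℕ))) v)
  have hW : finrank F W = r + 1 := by
    have hli' := hli.comp (fun j : Fin (r + 1) => (⟨2 * j, by lia⟩ : Fin (2 * r + 1)))
      (fun i j h => by simpa [Fin.ext_iff] using h)
    exact (finrank_span_eq_card hli').trans (by simp)
  have hrange : LinearMap.range ev ≤ LinearMap.BilinForm.orthogonal B W := by
    rintro _ ⟨⟨Y, hY⟩, rfl⟩
    rw [hev]
    refine apply_eq_zero_of_mem_span ?_
    rintro _ ⟨j, rfl⟩
    beta_reduce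
    rw [two_mul, pow_add, Module.End.mul_apply, pow_skew hN, ← hcomm Y hY,
      apply_self_eq_zero_of_skew hsymm hY.1, mul_zero]
  have h1 := finrank_mono hrange
  rw [LinearMap.finrank_range_of_inj hinj, LinearMap.BilinForm.finrank_orthogonal hB, hW] at h1
  have h2 := finrank_le W
  lia

/-- A totally isotropic family extends to a hyperbolic family together with an anisotropic
orthogonal family spanning the orthogonal complement. -/
theorem exists_hyperbolic_completion [CharZero F] [FiniteDimensional F V]
    (hsymm : ∀ v w, B v w = B w v) (hnd : ∀ v, (∀ w, B v w = 0) → v = 0)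
    {r : ℕ} {u : Fin r → V} (hu : LinearIndependent F u) (huu : ∀ i j, B (u i) (u j) = 0) :
    ∃ (m : ℕ) (w : Fin r → V) (e : Fin m → V), finrank F V = 2 * r + m ∧
      (∀ i j, B (u i) (w j) = if i = j then 1 else 0) ∧ (∀ i j, B (w i) (w j) = 0) ∧
      (∀ i j, B (u i) (e j) = 0) ∧ (∀ i j, B (w i) (e j) = 0) ∧
      (∀ i j, i ≠ j → B (e i) (e j) = 0) ∧ ∀ i, B (e i) (e i) ≠ 0 := by
  have hB := nondegenerate_of_symm hsymm hnd
  have hdual : ∀ j, ∃ x, ∀ i, B (u i) x = if i = j then 1 else 0 := by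
    intro j
    obtain ⟨g, hg⟩ := LinearMap.exists_extend ((Basis.span hu).coord j)
    obtain ⟨x, hx⟩ := (LinearMap.BilinForm.toDual B hB).surjective g
    refine ⟨x, fun i => ?_⟩
    rw [hsymm, ← LinearMap.BilinForm.toDual_def hB, hx]
    have h1 := LinearMap.congr_fun hg (Basis.span hu i)
    rw [Basis.coord_apply, Basis.repr_self, Finsupp.single_apply, LinearMap.comp_apply,
      subtype_apply, Basis.span_apply] at h1
    exact h1
  choose x hx using hdual
  let w : Fin r → V := fun i => x i - (2⁻¹ : F) • ∑ j, B (x i) (x j) • u j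
  have huw : ∀ i j, B (u i) (w j) = if i = j then 1 else 0 := by
    intro i j
    simp [w, hx, huu]
  have hww : ∀ i j, B (w i) (w j) = 0 := by
    intro i j
    have h1 : B (w i) (w j) = B (w i) (x j) - 2⁻¹ * ∑ k, B (x j) (x k) * B (u k) (w i) := by
      conv_lhs => rw [show w j = x j - (2⁻¹ : F) • ∑ k, B (x j) (x k) • u k from rfl]
      simp only [map_sub, map_smul, map_sum, smul_eq_mul, hsymm (w i) (u _)]
    have h2 : B (w i) (x j) = B (x i) (x j) - 2⁻¹ * B (x i) (x j) := by
      simp [w, hx]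
    rw [h1, h2]
    simp only [huw, mul_ite, mul_one, mul_zero, Finset.sum_ite_eq', Finset.mem_univ, if_true,
      hsymm (x j)]
    ring
  have hli : LinearIndependent F (Sum.elim u w) := by
    rw [Fintype.linearIndependent_iff]
    intro g hg
    simp only [Fintype.sum_sum_type, Sum.elim_inl, Sum.elim_inr] at hg
    rintro (i | i)
    · have := congrArg (B (w i)) hg
      simpa [hww, hsymm _ (u _), huw] using this
    · have := congrArg (B (u i)) hg
      simpa [huu, huw] using this
  let H := span F (Set.range (Sum.elim u w))
  have hH : finrank F H = 2 * r := by
    rw [finrank_span_eq_card hli]; simp [two_mul]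
  let W := LinearMap.BilinForm.orthogonal B H
  have hrefl : LinearMap.BilinForm.IsRefl B := fun a b h => by rw [hsymm, h]
  have hdisj : Disjoint H W := by
    rw [disjoint_def]
    intro z hz hzW
    obtain ⟨g, rfl⟩ := (mem_span_range_iff_exists_fun F).1 hz
    have h0 : ∀ s, B (Sum.elim u w s) (∑ t, g t • Sum.elim u w t) = 0 := fun s =>
      hzW _ (subset_span ⟨s, rfl⟩)
    have hg : ∀ t, g t = 0 := by
      rintro (i | i)
      · simpa [hww, hsymm _ (u _), huw] using h0 (Sum.inr i)
      · simpa [huu, huw] using h0 (Sum.inl i)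
    simp [hg]
  have hWnd : (LinearMap.BilinForm.restrict B W).Nondegenerate := by
    apply LinearMap.BilinForm.nondegenerate_restrict_of_disjoint_orthogonal B hrefl
    rw [LinearMap.BilinForm.orthogonal_orthogonal hB hrefl]
    exact hdisj.symm
  have hWsymm : LinearMap.IsSymm (LinearMap.BilinForm.restrict B W) := ⟨fun a b => hsymm a b⟩
  have : Invertible (2 : F) := invertibleOfNonzero two_ne_zero
  obtain ⟨b, hb⟩ := LinearMap.BilinForm.exists_orthogonal_basis
    (B := LinearMap.BilinForm.restrict B W) hWsymm
  have hbW : ∀ s i, B (Sum.elim u w s) (b i) = 0 := fun s i => (b i).2 _ (subset_span ⟨s, rfl⟩)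
  refine ⟨finrank F W, w, fun i => b i, ?_, huw, hww, fun i => hbW (Sum.inl i),
    fun i => hbW (Sum.inr i), fun i j hij => hb hij, fun i => ?_⟩
  · have := finrank_le H
    rw [LinearMap.BilinForm.finrank_orthogonal hB, hH]
    lia
  · exact LinearMap.BilinForm.iIsOrtho.not_isOrtho_basis_self_of_nondegenerate hb hWnd i

/-- A string of vectors with antidiagonal alternating Gram matrix is a Jordan string of some
skew nilpotent endomorphism. -/
theorem exists_skew_of_antidiagonal_gram (hsymm : ∀ v w, B v w = B w v) {r : ℕ} {x : ℕ → V}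
    {c : F} (hc : c ≠ 0)
    (hx : ∀ i ≤ 2 * r, ∀ j ≤ 2 * r, B (x i) (x j) = if i + j = 2 * r then (-1) ^ i * c else 0) :
    ∃ N : End F V, (∀ v w, B (N v) w + B v (N w) = 0) ∧ N ^ (2 * r + 1) = 0 ∧
      ∃ v, (N ^ (2 * r)) v ≠ 0 := by
  let N : End F V := c⁻¹ • ∑ j ∈ Finset.range (2 * r),
    ((-1 : F) ^ j • B (x (2 * r - j))).smulRight (x (j + 1))
  have hNv : ∀ v, N v = c⁻¹ • ∑ j ∈ Finset.range (2 * r),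
      ((-1 : F) ^ j * B (x (2 * r - j)) v) • x (j + 1) := fun v => by
    simp [N, LinearMap.sum_apply]
  have hstep : ∀ k < 2 * r, N (x k) = x (k + 1) := by
    intro k hk
    rw [hNv, Finset.sum_eq_single k]
    · rw [hx _ (by lia) _ hk.le, if_pos (by lia), smul_smul]
      have : (-1 : F) ^ (2 * r - k) = (-1) ^ k := by
        rw [neg_one_pow_eq_pow_mod_two, neg_one_pow_eq_pow_mod_two (n := k)]
        congr 1; lia
      rw [this, ← mul_assoc, ← mul_assoc, mul_assoc c⁻¹, ← mul_pow, neg_one_mul, neg_neg, one_pow,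
        mul_one, inv_mul_cancel₀ hc, one_smul]
    · intro j hj hjk
      rw [Finset.mem_range] at hj
      rw [hx _ (by lia) _ hk.le, if_neg (by lia), mul_zero, zero_smul]
    · simp [hk]
  have hlast : N (x (2 * r)) = 0 := by
    rw [hNv, Finset.sum_eq_zero, smul_zero]
    intro j hj
    rw [Finset.mem_range] at hj
    rw [hx _ (by lia) _ le_rfl, if_neg (by lia), mul_zero, zero_smul]
  have hpow : ∀ n k, k + n ≤ 2 * r → (N ^ n) (x k) = x (k + n) := by
    intro n
    induction n with
    | zero => simp
    | succ n ih =>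
      intro k hk
      rw [pow_succ', Module.End.mul_apply, ih k (by lia), hstep _ (by lia), add_assoc]
  have hpow0 : ∀ k, 1 ≤ k → k ≤ 2 * r → (N ^ (2 * r)) (x k) = 0 := by
    intro k h1 hk
    have hsplit : 2 * r = (k - 1) + 1 + (2 * r - k) := by lia
    have hend : (N ^ ((k - 1) + 1)) (x (k + (2 * r - k))) = 0 := by
      rw [Nat.add_sub_cancel' hk, pow_succ, Module.End.mul_apply, hlast, map_zero]
    rw [hsplit, pow_add, Module.End.mul_apply, hpow _ _ (by lia), hend]
  refine ⟨N, fun v w => ?_, ?_, x 0, ?_⟩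
  · simp only [hNv, map_smul, map_sum, LinearMap.smul_apply, LinearMap.sum_apply, smul_eq_mul]
    rw [← mul_add, ← Finset.sum_range_reflect, ← Finset.sum_add_distrib, Finset.sum_eq_zero,
      mul_zero]
    intro j hj
    rw [Finset.mem_range] at hj
    have : (-1 : F) ^ (2 * r - 1 - j) = -(-1) ^ j := by
      rw [← mul_neg_one ((-1 : F) ^ j), ← pow_succ, neg_one_pow_eq_pow_mod_two,
        neg_one_pow_eq_pow_mod_two (n := j + 1)]
      congr 1; lia
    rw [this, show 2 * r - (2 * r - 1 - j) = j + 1 by lia,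
      show 2 * r - 1 - j + 1 = 2 * r - j by lia, hsymm v]
    ring
  · ext v
    rw [pow_succ, Module.End.mul_apply, hNv, map_smul, map_sum, Finset.sum_eq_zero, smul_zero,
      LinearMap.zero_apply]
    intro j hj
    rw [Finset.mem_range] at hj
    rw [map_smul, hpow0 _ (by lia) (by lia), smul_zero]
  · intro h
    rw [hpow _ _ (by lia), zero_add] at h
    have := hx 0 (by lia) (2 * r) le_rfl
    rw [h, map_zero, if_pos (by lia)] at this
    exact hc (by simpa using this.symm)

/-- A totally isotropic subspace of dimension less than half that of the whole space yields
a skew nilpotent endomorphism with a large Jordan block. -/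
theorem exists_skew_of_isotropic [CharZero F] [FiniteDimensional F V]
    (hsymm : ∀ v w, B v w = B w v) (hnd : ∀ v, (∀ w, B v w = 0) → v = 0)
    {U : Submodule F V} (hU : ∀ u ∈ U, ∀ u' ∈ U, B u u' = 0) {r : ℕ} (hr : finrank F U = r)
    (hdim : 2 * r < finrank F V) :
    ∃ N : End F V, (∀ v w, B (N v) w + B v (N w) = 0) ∧ N ^ (2 * r + 1) = 0 ∧
      ∃ v, (N ^ (2 * r)) v ≠ 0 := by
  let b := finBasisOfFinrankEq F U hr
  obtain ⟨m, w, e, hm, huw, hww, hue, hwe, -, hee⟩ := exists_hyperbolic_completion hsymm hnd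
    (u := fun i => (b i : V)) (b.linearIndependent.map' U.subtype (ker_subtype U))
    fun i j => hU _ (b i).2 _ (b j).2
  let a : V := e ⟨0, by lia⟩
  let x : ℕ → V := fun j =>
    if h : j < r then w ⟨j, h⟩ else if j = r then a else
    if h : 2 * r - j < r then ((-1) ^ j * ((-1) ^ r * B a a)) • (b ⟨2 * r - j, h⟩ : V) else 0
  have ha : B a a ≠ 0 := hee _
  have huu : ∀ i j, B (b i : V) (b j) = 0 := fun i j => hU _ (b i).2 _ (b j).2
  have hau : ∀ i, B a (b i) = 0 := fun i => by rw [hsymm]; exact hue i _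
  have haw : ∀ i, B a (w i) = 0 := fun i => by rw [hsymm]; exact hwe i _
  have hwu : ∀ i j, B (w j) (b i) = if i = j then 1 else 0 := fun i j => by rw [hsymm]; exact huw i j
  have hsign : ∀ i j, i + j = 2 * r → (-1 : F) ^ i = (-1) ^ j := fun i j h => by
    rw [neg_one_pow_eq_pow_mod_two, neg_one_pow_eq_pow_mod_two (n := j)]
    congr 1; lia
  refine exists_skew_of_antidiagonal_gram hsymm (x := x) (c := (-1) ^ r * B a a)
    (mul_ne_zero (pow_ne_zero _ (by simp)) ha) fun i hi j hj => ?_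
  have hxw : ∀ j (h : j < r), x j = w ⟨j, h⟩ := fun j h => dif_pos h
  have hxa : x r = a := by simp [x]
  have hxu : ∀ j (h : r < j) (h' : j ≤ 2 * r), x j =
      ((-1) ^ j * ((-1) ^ r * B a a)) • (b ⟨2 * r - j, by lia⟩ : V) := fun j h h' => by
    simp only [x]
    rw [dif_neg (by lia), if_neg (by lia), dif_pos (by lia)]
  rcases lt_trichotomy i r with h1 | h1 | h1 <;> rcases lt_trichotomy j r with h2 | h2 | h2
  · rw [hxw _ h1, hxw _ h2, hww, if_neg (by lia)]
  · rw [hxw _ h1, h2, hxa, hwe, if_neg (by lia)]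
  · rw [hxw _ h1, hxu _ h2 hj, map_smul, hwu]
    by_cases h : i + j = 2 * r
    · simp [h, hsign i j h, show 2 * r - j = i by lia]
    · simp [h, Fin.ext_iff, show 2 * r - j ≠ i by lia]
  · rw [h1, hxw _ h2, hxa, haw, if_neg (by lia)]
  · rw [h1, h2, hxa, if_pos (by lia), ← mul_assoc, ← mul_pow]
    simp
  · rw [h1, hxa, hxu _ h2 hj, map_smul, hau, if_neg (by lia), smul_zero]
  · rw [hxu _ h1 hi, hxw _ h2, map_smul, LinearMap.smul_apply, huw]
    by_cases h : i + j = 2 * r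
    · simp [h, show 2 * r - i = j by lia]
    · simp [h, Fin.ext_iff, show 2 * r - i ≠ j by lia]
  · rw [hxu _ h1 hi, h2, hxa, map_smul, LinearMap.smul_apply, hue, if_neg (by lia), smul_zero]
  · rw [hxu _ h1 hi, hxu _ h2 hj, map_smul, LinearMap.map_smul, LinearMap.smul_apply, huu,
      if_neg (by lia), smul_zero, smul_zero]

/-- A skew nilpotent endomorphism admits an isotropic flag `u` which it strictly lowers, and
such that it acts trivially on the orthogonal complement modulo the span of `u`. -/
theorem exists_maximal_isotropic_flag [FiniteDimensional F V] (hsymm : ∀ v w, B v w = B w v)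
    {N : End F V} (hnil : IsNilpotent N) (hN : ∀ v w, B (N v) w + B v (N w) = 0) :
    ∃ (r : ℕ) (u : Fin r → V), LinearIndependent F u ∧ (∀ i j, B (u i) (u j) = 0) ∧
      (∀ i, N (u i) ∈ span F (u '' Set.Iio i)) ∧
      ∀ v, (∀ i, B (u i) v = 0) → N v ∈ span F (Set.range u) := by
  by_contra! hcon
  suffices h : ∀ r : ℕ, ∃ u : Fin r → V, LinearIndependent F u ∧ (∀ i j, B (u i) (u j) = 0) ∧
      ∀ i, N (u i) ∈ span F (u '' Set.Iio i) by
    obtain ⟨u, hu, -⟩ := h (finrank F V + 1)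
    simpa using hu.fintype_card_le_finrank
  intro r
  induction r with
  | zero => exact ⟨Fin.elim0, linearIndependent_empty_type, fun i => i.elim0, fun i => i.elim0⟩
  | succ r ih =>
  obtain ⟨u, hu, huu, hflag⟩ := ih
  obtain ⟨v, hv, hNv⟩ := hcon r u hu huu hflag
  have hstab : ∀ z ∈ span F (Set.range u), N z ∈ span F (Set.range u) := by
    refine map_mem_of_mem_span ?_
    rintro _ ⟨i, rfl⟩
    exact span_mono (Set.image_subset_range _ _) (hflag i)
  have hperp : ∀ z ∈ span F (Set.range u), ∀ y, (∀ i, B (u i) y = 0) → B z y = 0 := by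
    intro z hz y hy
    refine apply_eq_zero_of_mem_span ?_ z hz
    rintro _ ⟨i, rfl⟩
    exact hy i
  have hex : ∃ n, (N ^ n) v ∈ span F (Set.range u) := by
    obtain ⟨n, hn⟩ := hnil
    exact ⟨n, by simp [hn]⟩
  classical
  obtain ⟨n, hn⟩ : ∃ n, Nat.find hex = n + 2 := by
    refine ⟨Nat.find hex - 2, ?_⟩
    have h0 : Nat.find hex ≠ 0 := fun h => by
      have := Nat.find_spec hex
      rw [h, pow_zero, Module.End.one_apply] at this
      exact hNv (hstab _ this)
    have h1 : Nat.find hex ≠ 1 := fun h => by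
      have := Nat.find_spec hex
      rw [h, pow_one] at this
      exact hNv this
    lia
  have hspec := Nat.find_spec hex
  rw [hn] at hspec
  have hmin : (N ^ (n + 1)) v ∉ span F (Set.range u) := Nat.find_min hex (by lia)
  have hup : ∀ k i, B (u i) ((N ^ k) v) = 0 := by
    intro k
    induction k with
    | zero => simpa using hv
    | succ k ihk =>
      intro i
      rw [pow_succ', Module.End.mul_apply, eq_neg_of_add_eq_zero_right (hN _ _),
        hperp _ (hstab _ (subset_span ⟨i, rfl⟩)) _ ihk, neg_zero]
  have hself : B ((N ^ (n + 1)) v) ((N ^ (n + 1)) v) = 0 := by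
    rw [pow_skew hN, ← Module.End.mul_apply, ← pow_add, hsymm, hperp _ _ v hv, mul_zero]
    rw [show n + 1 + (n + 1) = n + (n + 2) by lia, pow_add, Module.End.mul_apply]
    have : ∀ k, ∀ z ∈ span F (Set.range u), (N ^ k) z ∈ span F (Set.range u) := by
      intro k z hz
      induction k with
      | zero => simpa using hz
      | succ k ihk => rw [pow_succ', Module.End.mul_apply]; exact hstab _ ihk
    exact this _ _ hspec
  refine ⟨Fin.snoc u ((N ^ (n + 1)) v), hu.finSnoc hmin, fun i j => ?_, fun i => ?_⟩
  · induction i using Fin.lastCases with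
    | last =>
      induction j using Fin.lastCases with
      | last => simpa using hself
      | cast j => simpa using (hsymm _ _).trans (hup _ _)
    | cast i =>
      induction j using Fin.lastCases with
      | last => simpa using hup _ _
      | cast j => simpa using huu i j
  · induction i using Fin.lastCases with
    | last =>
      rw [Fin.snoc_last, ← Module.End.mul_apply, ← pow_succ']
      refine span_mono ?_ hspec
      rintro _ ⟨i, rfl⟩
      exact ⟨i.castSucc, Fin.castSucc_lt_last i, by simp⟩
    | cast i =>
      rw [Fin.snoc_castSucc]
      refine span_mono ?_ (hflag i)
      rintro _ ⟨j, hj, rfl⟩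
      exact ⟨j.castSucc, Fin.castSucc_lt_castSucc_iff.2 hj, by simp⟩

/-- The endomorphism `v ↦ B y v • x - B x v • y`, corresponding to `x ∧ y` under the identification
of the skew endomorphisms with the exterior square. -/
def wedgeEnd (B : V →ₗ[F] V →ₗ[F] F) (x y : V) : End F V :=
  (B y).smulRight x - (B x).smulRight y

theorem wedgeEnd_apply (x y v : V) : wedgeEnd B x y v = B y v • x - B x v • y := rfl

theorem wedgeEnd_skew (hsymm : ∀ v w, B v w = B w v) (x y v w : V) :
    B (wedgeEnd B x y v) w + B v (wedgeEnd B x y w) = 0 := by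
  simp only [wedgeEnd_apply, map_sub, map_smul, LinearMap.sub_apply, LinearMap.smul_apply,
    smul_eq_mul, hsymm v]
  ring

/-- A skew endomorphism acting trivially on the successive quotients of the isotropic flag `u` and
of its orthogonal complement commutes with many skew endomorphisms: the bound is the dimension of
a space of linear functionals, on the stabilizer of the flag, vanishing on commutators. -/
theorem le_finrank_soCent_of_flag [FiniteDimensional F V]
    (hsymm : ∀ v w, B v w = B w v)
    {N : End F V} (hN : ∀ v w, B (N v) w + B v (N w) = 0) {r k : ℕ} {u w : Fin r → V} {a : V}
    {f : Fin k → V} (huu : ∀ i j, B (u i) (u j) = 0)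
    (huw : ∀ i j, B (u i) (w j) = if i = j then 1 else 0)
    (hflag : ∀ i, N (u i) ∈ span F (u '' Set.Iio i))
    (hperp : ∀ v, (∀ i, B (u i) v = 0) → N v ∈ span F (Set.range u))
    (hua : ∀ i, B (u i) a = 0) (huf : ∀ i j, B (u i) (f j) = 0) (haf : ∀ j, B a (f j) = 0)
    (hff : ∀ i j, i ≠ j → B (f i) (f j) = 0) (hne : ∀ i, B a a * B (f i) (f i) ≠ 0) :
    r + k ≤ finrank F (soCent F V B N) := by
  let P : Submodule F (End F V) :=
    soCent F V B 0 ⊓ ⨅ i, (span F (u '' Set.Iic i)).comap (LinearMap.applyₗ (u i))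
  have hP : ∀ X, X ∈ P ↔ (∀ v w, B (X v) w + B v (X w) = 0) ∧
      ∀ i, X (u i) ∈ span F (u '' Set.Iic i) := by
    intro X
    have : X ∈ soCent F V B 0 ↔ ∀ v w, B (X v) w + B v (X w) = 0 :=
      ⟨fun h => h.1, fun h => ⟨h, by simp⟩⟩
    simp [P, this]
  have hX_Iio : ∀ X ∈ P, ∀ i, ∀ z ∈ span F (u '' Set.Iio i), X z ∈ span F (u '' Set.Iio i) := by
    refine fun X hX i => map_mem_of_mem_span ?_
    rintro _ ⟨j, hj, rfl⟩
    exact span_mono (Set.image_mono (Set.Iic_subset_Iio.2 hj)) (((hP X).1 hX).2 j)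
  have hN_Iic : ∀ i, ∀ z ∈ span F (u '' Set.Iic i), N z ∈ span F (u '' Set.Iio i) := by
    refine fun i => map_mem_of_mem_span ?_
    rintro _ ⟨j, hj, rfl⟩
    exact span_mono (Set.image_mono (Set.Iio_subset_Iio hj)) (hflag j)
  have hX_range : ∀ X ∈ P, ∀ z ∈ span F (Set.range u), X z ∈ span F (Set.range u) := by
    refine fun X hX => map_mem_of_mem_span ?_
    rintro _ ⟨j, rfl⟩
    exact span_mono (Set.image_subset_range _ _) (((hP X).1 hX).2 j)
  have hrange_perp : ∀ y, (∀ i, B (u i) y = 0) → ∀ z ∈ span F (Set.range u), B z y = 0 :=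
    fun y hy => apply_eq_zero_of_mem_span (by rintro _ ⟨i, rfl⟩; exact hy i)
  have hcomm_Iio : ∀ X ∈ P, ∀ i, N (X (u i)) - X (N (u i)) ∈ span F (u '' Set.Iio i) :=
    fun X hX i => sub_mem (hN_Iic i _ (((hP X).1 hX).2 i)) (hX_Iio X hX i _ (hflag i))
  have hcomm : ∀ X ∈ P, (LinearMap.mulLeft F N - LinearMap.mulRight F N) X ∈ P := by
    intro X hX
    refine (hP _).2 ⟨fun v w => ?_, fun i => ?_⟩
    · have hXs := ((hP X).1 hX).1
      simp only [LinearMap.sub_apply, LinearMap.mulLeft_apply, LinearMap.mulRight_apply,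
        Module.End.mul_apply, map_sub]
      linear_combination hN (X v) w - hXs v (N w) - hXs (N v) w + hN v (X w)
    · exact span_mono (Set.image_mono Set.Iio_subset_Iic_self) (hcomm_Iio X hX i)
  let D : P →ₗ[F] P := (LinearMap.mulLeft F N - LinearMap.mulRight F N).restrict hcomm
  let φ : P →ₗ[F] (Fin r ⊕ Fin k → F) := LinearMap.pi (Sum.elim
    (fun i => B.flip (w i) ∘ₗ LinearMap.applyₗ (u i) ∘ₗ P.subtype)
    (fun i => B.flip (f i) ∘ₗ LinearMap.applyₗ a ∘ₗ P.subtype))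
  have hφl : ∀ X i, φ X (Sum.inl i) = B (X.1 (u i)) (w i) := fun _ _ => rfl
  have hφr : ∀ X i, φ X (Sum.inr i) = B (X.1 a) (f i) := fun _ _ => rfl
  have hφD : LinearMap.range D ≤ LinearMap.ker φ := by
    rintro _ ⟨⟨X, hX⟩, rfl⟩
    rw [LinearMap.mem_ker]
    have hD : ∀ v, (D ⟨X, hX⟩).1 v = N (X v) - X (N v) := fun _ => rfl
    ext (i | i)
    · rw [hφl, hD]
      refine apply_eq_zero_of_mem_span ?_ _ (hcomm_Iio X hX i)
      rintro _ ⟨j, hj, rfl⟩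
      rw [huw, if_neg (ne_of_lt hj)]
    · rw [hφr, hD]
      refine hrange_perp _ (fun j => huf j i) _
        (sub_mem (hperp _ fun j => ?_) (hX_range X hX _ (hperp _ hua)))
      rw [eq_neg_of_add_eq_zero_right (((hP X).1 hX).1 _ _),
        hrange_perp _ hua _ (hX_range X hX _ (subset_span ⟨j, rfl⟩)), neg_zero]
  have hφ : LinearMap.range φ = ⊤ := by
    rw [eq_top_iff, ← (Pi.basisFun F (Fin r ⊕ Fin k)).span_eq, span_le]
    rintro _ ⟨i | i, rfl⟩
    · have hmem : wedgeEnd B (u i) (w i) ∈ P := by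
        refine (hP _).2 ⟨wedgeEnd_skew hsymm _ _, fun j => ?_⟩
        rw [wedgeEnd_apply, huu, hsymm, huw]
        by_cases h : j = i
        · subst h
          have hj : u j ∈ span F (u '' Set.Iic j) := subset_span ⟨j, Set.self_mem_Iic, rfl⟩
          simpa using hj
        · simp [h]
      refine ⟨⟨_, hmem⟩, ?_⟩
      ext (j | j)
      · rw [hφl]
        simp only [wedgeEnd_apply, huu, hsymm (w i), huw]
        by_cases h : j = i
        · subst h
          simp [huw]
        · simp [h]
      · rw [hφr]
        simp [wedgeEnd_apply, hua, huf]
    · have hmem : wedgeEnd B a (f i) ∈ P := by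
        refine (hP _).2 ⟨wedgeEnd_skew hsymm _ _, fun j => ?_⟩
        simp [wedgeEnd_apply, hsymm _ (u j), hua, huf]
      refine ⟨(-(B a a * B (f i) (f i))⁻¹) • ⟨_, hmem⟩, ?_⟩
      rw [map_smul]
      ext (j | j)
      · rw [Pi.smul_apply, hφl]
        simp [wedgeEnd_apply, hsymm _ (u j), hua, huf]
      · rw [Pi.smul_apply, hφr]
        by_cases h : j = i
        · subst h
          have hval : B (wedgeEnd B a (f j) a) (f j) = -(B a a * B (f j) (f j)) := by
            simp [wedgeEnd_apply, haf, hsymm (f j) a]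
          rw [hval, smul_eq_mul, Pi.basisFun_apply, Pi.single_eq_same, neg_mul_neg,
            inv_mul_cancel₀ (hne j)]
        · simp [wedgeEnd_apply, haf, hsymm (f i) a, hff i j (Ne.symm h), h]
  have hker : (LinearMap.ker D).map P.subtype ≤ soCent F V B N := by
    rintro _ ⟨⟨X, hX⟩, hXD, rfl⟩
    exact ⟨((hP X).1 hX).1, sub_eq_zero.1 (congrArg Subtype.val hXD)⟩
  have h1 := finrank_mono hker
  rw [finrank_map_subtype_eq] at h1
  have h2 := finrank_mono hφD
  have h3 := D.finrank_range_add_finrank_ker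
  have h4 := φ.finrank_range_add_finrank_ker
  rw [hφ, finrank_top] at h4
  simp only [finrank_fintype_fun_eq_card, Fintype.card_sum, Fintype.card_fin] at h4
  lia

/-- Every skew nilpotent endomorphism gives rise to a totally isotropic subspace whose dimension
controls the centralizer from below. -/
theorem exists_isotropic_le_finrank_soCent [CharZero F] [FiniteDimensional F V]
    (hsymm : ∀ v w, B v w = B w v) (hnd : ∀ v, (∀ w, B v w = 0) → v = 0)
    {N : End F V} (hnil : IsNilpotent N) (hN : ∀ v w, B (N v) w + B v (N w) = 0) :
    ∃ (r m : ℕ) (U : Submodule F V), finrank F U = r ∧ (∀ u ∈ U, ∀ u' ∈ U, B u u' = 0) ∧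
      finrank F V = 2 * r + m ∧ r + (m - 1) ≤ finrank F (soCent F V B N) := by
  obtain ⟨r, u, hu, huu, hflag, hperp⟩ := exists_maximal_isotropic_flag hsymm hnil hN
  obtain ⟨m, w, e, hm, huw, -, hue, -, hee, hne⟩ := exists_hyperbolic_completion hsymm hnd hu huu
  refine ⟨r, m, span F (Set.range u), by simp [finrank_span_eq_card hu], ?_, hm, ?_⟩
  · intro x hx y hy
    obtain ⟨c, rfl⟩ := (mem_span_range_iff_exists_fun F).1 hx
    obtain ⟨c', rfl⟩ := (mem_span_range_iff_exists_fun F).1 hy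
    simp [huu]
  · cases m with
    | zero =>
      exact le_finrank_soCent_of_flag hsymm hN (a := 0) (f := Fin.elim0) huu huw hflag hperp
        (by simp) (fun _ i => i.elim0) (fun i => i.elim0) (fun i => i.elim0) (fun i => i.elim0)
    | succ k =>
      exact le_finrank_soCent_of_flag hsymm hN (a := e 0) (f := fun i => e i.succ) huu huw hflag
        hperp (fun i => hue i 0) (fun i j => hue i _) (fun j => hee _ _ (Fin.succ_ne_zero j).symm)
        (fun i j h => hee _ _ (by simpa using h)) (fun i => mul_ne_zero (hne _) (hne _))

end SkewEndomorphisms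

/-- For a nondegenerate symmetric bilinear form `B` on a
`d`-dimensional space `V` (char 0, `d ≥ 1`), the Lie algebra `so(V, B)` contains a
regular nilpotent element — i.e. a nilpotent `N ∈ so(V, B)` whose centralizer in
`so(V, B)` has dimension `⌊d/2⌋` — if and only if `B` admits a totally isotropic
subspace of dimension `⌈d/2⌉ − 1` (the form is quasi-split). -/
theorem stmt_17 (F V : Type*) [Field F] [CharZero F] [AddCommGroup V] [Module F V]
    [FiniteDimensional F V] (d : ℕ) (hd : Module.finrank F V = d) (hd1 : 1 ≤ d)
    (B : V →ₗ[F] V →ₗ[F] F)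
    (hsymm : ∀ v w : V, B v w = B w v)
    (hnd : ∀ v : V, (∀ w : V, B v w = 0) → v = 0) :
    (∃ N : Module.End F V, IsNilpotent N ∧ (∀ v w : V, B (N v) w + B v (N w) = 0) ∧
      Module.finrank F ↥(soCent F V B N) = d / 2) ↔
    (∃ U : Submodule F V, Module.finrank F ↥U = (d + 1) / 2 - 1 ∧
      ∀ u ∈ U, ∀ u' ∈ U, B u u' = 0) := by
  constructor
  · rintro ⟨N, hnil, hN, hdim⟩
    obtain ⟨r, m, U, hUr, hU, hrm, hle⟩ := exists_isotropic_le_finrank_soCent hsymm hnd hnil hN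
    obtain ⟨U', hU'U, hU'⟩ := exists_submodule_le_finrank_eq (F := F) (U := U)
      (n := (d + 1) / 2 - 1) (by lia)
    exact ⟨U', hU', fun u hu u' hu' => hU u (hU'U hu) u' (hU'U hu')⟩
  · rintro ⟨U, hUr, hU⟩
    obtain ⟨N, hN, hpow, v, hv⟩ := exists_skew_of_isotropic hsymm hnd hU hUr (by lia)
    refine ⟨N, ⟨_, hpow⟩, hN, ?_⟩
    have hupper := finrank_soCent_add_le hsymm hnd hN (by rw [hpow, LinearMap.zero_apply]) hv
      (by lia)
    obtain ⟨r, m, -, -, -, hrm, hle⟩ := exists_isotropic_le_finrank_soCent hsymm hnd ⟨_, hpow⟩ hN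
    lia
end

section
/- Let F be a field, n ≥ 1, and let D be the n×n diagonal matrix over F with diagonal entries d_1, …, d_n, all nonzero. If b is an upper triangular n×n matrix over F satisfying bᵀ·D·b = D, then b is diagonal and b_{ii}² = 1 for every i. In particular, if in addition all diagonal entries of b equal 1 (b is upper unitriangular), then b is the identity matrix; that is, the intersection of the standard unipotent upper triangular group with the orthogonal group of a nondegenerate diagonal form is trivial, and the intersection of the upper triangular Borel with this orthogonal group consists of the diagonal matrices with entries ±1. -/
namespace Matrix

variable {ι F : Type*} [Fintype ι] [LinearOrder ι] [Field F]

/-- If the entries of column `i` of `b` off the diagonal vanish, then the `(i, j)` entry of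
`bᵀ * diagonal d * b` is a single product. -/
theorem transpose_mul_diagonal_mul_apply_of_col_eq_zero {b : Matrix ι ι F} {d : ι → F} {i : ι}
    (h : ∀ k, k ≠ i → b k i = 0) (j : ι) :
    (bᵀ * diagonal d * b) i j = b i i * d i * b i j := by
  rw [mul_apply, Finset.sum_eq_single i]
  · simp [mul_diagonal]
  · intro k _ hk
    simp [mul_diagonal, h k hk]
  · simp

/-- An upper triangular isometry of a nondegenerate diagonal form is diagonal. -/
theorem BlockTriangular.eq_zero_of_transpose_mul_diagonal_mul {b : Matrix ι ι F} {d : ι → F}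
    (hb : b.BlockTriangular id) (hd : ∀ i, d i ≠ 0)
    (h : bᵀ * diagonal d * b = diagonal d) (i : ι) : ∀ j, i ≠ j → b i j = 0 := by
  induction i using WellFoundedLT.induction with
  | ind i ih =>
    intro j hij
    have col : ∀ k, k ≠ i → b k i = 0 := fun k hk =>
      hk.lt_or_gt.elim (fun hlt => ih k hlt i hk) (fun hgt => hb hgt)
    have entry (j : ι) : b i i * d i * b i j = diagonal d i j := by
      rw [← transpose_mul_diagonal_mul_apply_of_col_eq_zero col j, h]
    have hii : b i i ≠ 0 := by
      intro h0
      have := entry i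
      simp [h0, (hd i).symm] at this
    have := entry j
    simpa [diagonal_apply_ne d hij, hii, hd i] using this

/-- The diagonal entries of an upper triangular isometry of a nondegenerate diagonal form
square to `1`. -/
theorem BlockTriangular.diag_sq_eq_one_of_transpose_mul_diagonal_mul {b : Matrix ι ι F}
    {d : ι → F} (hb : b.BlockTriangular id) (hd : ∀ i, d i ≠ 0)
    (h : bᵀ * diagonal d * b = diagonal d) (i : ι) : b i i ^ 2 = 1 := by
  have entry := transpose_mul_diagonal_mul_apply_of_col_eq_zero (d := d)
    (fun k hk => hb.eq_zero_of_transpose_mul_diagonal_mul hd h k i hk) i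
  rw [h, diagonal_apply_eq] at entry
  apply mul_right_cancel₀ (hd i)
  linear_combination -entry

end Matrix


/-- Let `F` be a field, `n ≥ 1`, and `D = diagonal d` an invertible
diagonal `n×n` matrix.  If an upper triangular matrix `b` satisfies `bᵀ·D·b = D`, then
`b` is diagonal with `b_{ii}² = 1` for every `i`; in particular if moreover all diagonal
entries of `b` equal `1` (i.e. `b` is upper unitriangular), then `b = 1`. -/
theorem stmt_19 (F : Type*) [Field F] (n : ℕ) (hn : 1 ≤ n)
    (d : Fin n → F) (hd : ∀ i, d i ≠ 0)
    (b : Matrix (Fin n) (Fin n) F)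
    (hb : ∀ i j : Fin n, j < i → b i j = 0)
    (horth : b.transpose * Matrix.diagonal d * b = Matrix.diagonal d) :
    ((∀ i j : Fin n, i ≠ j → b i j = 0) ∧ (∀ i, b i i ^ 2 = 1)) ∧
      ((∀ i, b i i = 1) → b = 1) := by
  have hT : b.BlockTriangular id := fun i j hij => hb i j hij
  have off (i j : Fin n) (hij : i ≠ j) : b i j = 0 :=
    hT.eq_zero_of_transpose_mul_diagonal_mul hd horth i j hij
  refine ⟨⟨off, hT.diag_sq_eq_one_of_transpose_mul_diagonal_mul hd horth⟩, fun h1 => ?_⟩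
  ext i j
  by_cases hij : i = j
  · subst hij
    simp [h1]
  · rw [off i j hij, Matrix.one_apply_ne hij]
end
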